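/- arXiv:2409.09913 — 12 statements merged into one kernel-verified Lean document; each statement's English description precedes it below -/
import Mathlib

section
/- Let D ≥ 1 and let o, q ∈ ℝ^D be fixed unit vectors. Let P be a random D×D orthogonal matrix distributed according to the Haar probability measure on the orthogonal group O(D). Define x̄ ∈ ℝ^D by x̄[i] = sgn((Pᵀo)[i])/√D (with the convention sgn(0) = 1, which is irrelevant since (Pᵀo)[i] ≠ 0 almost surely), and set ō₀ := P x̄, which is a nearest vector to o in the codebook {P x : x ∈ {−1/√D, +1/√D}^D} and satisfies ⟨ō₀, o⟩ = (1/√D)·Σ_{i=1}^D |(Pᵀo)[i]| > 0. Then the estimator ⟨ō₀, q⟩ / ⟨ō₀, o⟩ is unbiased for ⟨o, q⟩, i.e., E_P[ ⟨ō₀, q⟩ / ⟨ō₀, o⟩ ] = ⟨o, q⟩. -/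
open MeasureTheory Matrix
open scoped RealInnerProductSpace

noncomputable section

instance (D : ℕ) : MeasurableSpace (Matrix (Fin D) (Fin D) ℝ) := borel _

/-- `sgn` with the convention `sgn 0 = 1`. -/
def sgn (x : ℝ) : ℝ := if x < 0 then -1 else 1

/-- The bi-valued vector `x̄` with `x̄ i = sgn ((Pᵀ o) i) / √D`. -/
def xbar (D : ℕ) (P : Matrix (Fin D) (Fin D) ℝ) (o : EuclideanSpace ℝ (Fin D)) :
    EuclideanSpace ℝ (Fin D) :=
  (WithLp.equiv 2 (Fin D → ℝ)).symm fun i =>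
    sgn (Matrix.toEuclideanLin Pᵀ o i) / Real.sqrt D

/-- The quantized vector `ō₀ = P x̄`, a nearest vector to `o` in the RaBitQ codebook
`{P x : x ∈ {−1/√D, +1/√D}^D}`. -/
def obar0 (D : ℕ) (P : Matrix (Fin D) (Fin D) ℝ) (o : EuclideanSpace ℝ (Fin D)) :
    EuclideanSpace ℝ (Fin D) :=
  Matrix.toEuclideanLin P (xbar D P o)

theorem xbar_apply' (D : ℕ) (P : Matrix (Fin D) (Fin D) ℝ) (o : EuclideanSpace ℝ (Fin D))
    (i : Fin D) : xbar D P o i = sgn (∑ k, P k i * o k) / Real.sqrt D := by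
  simp [xbar, Matrix.toLpLin_apply, Matrix.mulVec, dotProduct]

theorem obar0_apply' (D : ℕ) (P : Matrix (Fin D) (Fin D) ℝ) (o : EuclideanSpace ℝ (Fin D))
    (i : Fin D) : obar0 D P o i = ∑ j, P i j * (sgn (∑ k, P k j * o k) / Real.sqrt D) := by
  simp [obar0, Matrix.toLpLin_apply, Matrix.mulVec, dotProduct, xbar_apply']

theorem inner_sum' {D : ℕ} (a b : EuclideanSpace ℝ (Fin D)) : ⟪a, b⟫ = ∑ i, a i * b i := by
  simp [PiLp.inner_apply, mul_comm]

theorem inner_obar0_self (D : ℕ) (P : Matrix (Fin D) (Fin D) ℝ) (o : EuclideanSpace ℝ (Fin D)) :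
    ⟪obar0 D P o, o⟫ = (∑ j, |∑ k, P k j * o k|) / Real.sqrt D := by
  rw [inner_sum']
  simp only [obar0_apply', Finset.sum_mul]
  rw [Finset.sum_comm, Finset.sum_div]
  refine Finset.sum_congr rfl fun j _ => ?_
  have h : |∑ k, P k j * o k| = sgn (∑ k, P k j * o k) * ∑ k, P k j * o k := by
    unfold sgn
    split_ifs with h
    · rw [abs_of_neg h]; ring
    · rw [abs_of_nonneg (not_lt.1 h)]; ring
  rw [h, mul_div_right_comm, Finset.mul_sum]
  refine Finset.sum_congr rfl fun k _ => ?_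
  ring

theorem sum_sq_orth (D : ℕ) (P : Matrix (Fin D) (Fin D) ℝ) (hP : P * Pᵀ = 1)
    (o : EuclideanSpace ℝ (Fin D)) : ∑ j, (∑ k, P k j * o k) ^ 2 = ∑ k, o k ^ 2 := by
  have h1 : ∀ j, (∑ k, P k j * o k) = (Pᵀ *ᵥ o.ofLp) j := fun j => by
    simp [Matrix.mulVec, dotProduct]
  have h2 : (Pᵀ *ᵥ o.ofLp) ⬝ᵥ (Pᵀ *ᵥ o.ofLp) = o.ofLp ⬝ᵥ o.ofLp := by
    rw [Matrix.dotProduct_mulVec, Matrix.vecMul_transpose, Matrix.mulVec_mulVec, hP,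
      Matrix.one_mulVec]
  simp only [h1]
  simpa [dotProduct, sq] using h2

theorem sum_sq_of_norm {D : ℕ} {o : EuclideanSpace ℝ (Fin D)} (ho : ‖o‖ = 1) :
    ∑ k, o k ^ 2 = 1 := by
  have := EuclideanSpace.norm_sq_eq o
  simpa [ho] using this.symm

theorem denom_lb (D : ℕ) (P : Matrix (Fin D) (Fin D) ℝ) (hP : P * Pᵀ = 1)
    (o : EuclideanSpace ℝ (Fin D)) (ho : ‖o‖ = 1) :
    1 / Real.sqrt D ≤ ⟪obar0 D P o, o⟫ := by
  rw [inner_obar0_self]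
  gcongr
  have h := sum_sq_orth D P hP o
  rw [sum_sq_of_norm ho] at h
  rw [← h]
  refine Finset.sum_le_sum fun j hj => ?_
  rw [← sq_abs]
  have : (∑ k, P k j * o k) ^ 2 ≤ 1 := by
    rw [← h]
    exact Finset.single_le_sum (f := fun j => (∑ k, P k j * o k) ^ 2)
      (fun i _ => sq_nonneg _) hj
  have h1 := (sq_le_one_iff_abs_le_one _).1 this
  nlinarith [abs_nonneg (∑ k, P k j * o k)]

theorem obar0_norm_le (D : ℕ) (P : Matrix (Fin D) (Fin D) ℝ) (hP : P * Pᵀ = 1)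
    (o : EuclideanSpace ℝ (Fin D)) (i : Fin D) : |obar0 D P o i| ≤ D * (1 / Real.sqrt D) := by
  rw [obar0_apply']
  refine (Finset.abs_sum_le_sum_abs _ _).trans ?_
  calc _ ≤ ∑ j : Fin D, (1 / Real.sqrt D) := ?_
    _ = _ := by simp
  refine Finset.sum_le_sum fun j _ => ?_
  have hs : |sgn (∑ k, P k j * o k)| = 1 := by unfold sgn; split_ifs <;> simp
  rw [abs_mul, abs_div, hs, abs_of_nonneg (Real.sqrt_nonneg _)]
  have h1 : |P i j| ≤ 1 := by
    rw [← sq_le_one_iff_abs_le_one]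
    have h2 : ∑ j, P i j ^ 2 = 1 := by
      have := congrFun (congrFun hP i) i
      simpa [Matrix.mul_apply, sq] using this
    rw [← h2]
    exact Finset.single_le_sum (f := fun j => P i j ^ 2)
      (fun i _ => sq_nonneg _) (Finset.mem_univ j)
  have : 0 ≤ 1 / Real.sqrt D := by positivity
  nlinarith

theorem measurable_sgn' : Measurable sgn := by
  unfold sgn
  exact Measurable.ite measurableSet_Iio measurable_const measurable_const

instance borelMat (D : ℕ) : BorelSpace (Matrix (Fin D) (Fin D) ℝ) := ⟨rfl⟩

theorem measurable_entry (D : ℕ) (i j : Fin D) :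
    Measurable fun P : Matrix.orthogonalGroup (Fin D) ℝ => (P : Matrix (Fin D) (Fin D) ℝ) i j := by
  have : Measurable fun P : Matrix (Fin D) (Fin D) ℝ => P i j :=
    (continuous_id.matrix_elem i j).measurable
  exact this.comp measurable_subtype_coe

theorem measurable_inner_obar0 (D : ℕ) (o q : EuclideanSpace ℝ (Fin D)) :
    Measurable fun P : Matrix.orthogonalGroup (Fin D) ℝ =>
      ⟪obar0 D (P : Matrix (Fin D) (Fin D) ℝ) o, q⟫ := by
  simp only [inner_sum', obar0_apply']
  refine Finset.measurable_sum _ fun i _ => Measurable.mul_const ?_ _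
  refine Finset.measurable_sum _ fun j _ => (measurable_entry D i j).mul ?_
  refine (measurable_sgn'.comp ?_).div_const _
  exact Finset.measurable_sum _ fun k _ => (measurable_entry D k j).mul_const _

/-- The reflection through the line of `o`. -/
def refl' {D : ℕ} (o : EuclideanSpace ℝ (Fin D)) : Matrix (Fin D) (Fin D) ℝ :=
  (2 : ℝ) • Matrix.vecMulVec o.ofLp o.ofLp - 1

theorem refl_mulVec {D : ℕ} (o : EuclideanSpace ℝ (Fin D)) (v : Fin D → ℝ) :
    refl' o *ᵥ v = (2 * (o.ofLp ⬝ᵥ v)) • o.ofLp - v := by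
  ext i
  simp [refl', Matrix.sub_mulVec, Matrix.smul_mulVec, Matrix.vecMulVec_mulVec]
  ring

theorem refl_transpose {D : ℕ} (o : EuclideanSpace ℝ (Fin D)) : (refl' o)ᵀ = refl' o := by
  simp [refl', Matrix.transpose_vecMulVec]

theorem dot_self {D : ℕ} {o : EuclideanSpace ℝ (Fin D)} (ho : ‖o‖ = 1) :
    o.ofLp ⬝ᵥ o.ofLp = 1 := by
  simpa [dotProduct, sq] using sum_sq_of_norm ho

theorem refl_fix {D : ℕ} {o : EuclideanSpace ℝ (Fin D)} (ho : ‖o‖ = 1) :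
    refl' o *ᵥ o.ofLp = o.ofLp := by
  rw [refl_mulVec, dot_self ho]
  ext i; simp; ring

theorem refl_sq {D : ℕ} {o : EuclideanSpace ℝ (Fin D)} (ho : ‖o‖ = 1) :
    refl' o * refl' o = 1 := by
  refine Matrix.ext_of_mulVec_single fun i => ?_
  rw [← Matrix.mulVec_mulVec, refl_mulVec o (Pi.single i 1), Matrix.mulVec_sub,
    Matrix.mulVec_smul, refl_fix ho, refl_mulVec, sub_sub_cancel, Matrix.one_mulVec]

theorem obar0_refl {D : ℕ} {o : EuclideanSpace ℝ (Fin D)} (ho : ‖o‖ = 1)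
    (P : Matrix (Fin D) (Fin D) ℝ) :
    obar0 D (refl' o * P) o = (2 * ⟪obar0 D P o, o⟫) • o - obar0 D P o := by
  have hx : xbar D (refl' o * P) o = xbar D P o := by
    unfold xbar
    simp only [Matrix.toLpLin_apply, Matrix.transpose_mul, refl_transpose,
      ← Matrix.mulVec_mulVec, refl_fix ho]
  unfold obar0
  rw [hx]
  ext i
  simp only [Matrix.toLpLin_apply, ← Matrix.mulVec_mulVec, refl_mulVec, inner_sum']
  simp [dotProduct, mul_comm]

/-- the RaBitQ estimator `⟨ō₀, q⟩ / ⟨ō₀, o⟩` is an unbiased estimator of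
`⟨o, q⟩`, when `P` is Haar-distributed on the orthogonal group `O(D)`. -/
theorem rabitq_unbiased (D : ℕ) (hD : 1 ≤ D) (o q : EuclideanSpace ℝ (Fin D))
    (ho : ‖o‖ = 1) (hq : ‖q‖ = 1)
    (μ : Measure (Matrix.orthogonalGroup (Fin D) ℝ))
    (hHaar : μ.IsHaarMeasure) (hProb : IsProbabilityMeasure μ) :
    ∫ (P : Matrix.orthogonalGroup (Fin D) ℝ),
        ⟪obar0 D (P : Matrix (Fin D) (Fin D) ℝ) o, q⟫ /
          ⟪obar0 D (P : Matrix (Fin D) (Fin D) ℝ) o, o⟫ ∂μ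
      = ⟪o, q⟫ := by
  have hP : ∀ P : Matrix.orthogonalGroup (Fin D) ℝ,
      (P : Matrix (Fin D) (Fin D) ℝ) * (P : Matrix (Fin D) (Fin D) ℝ)ᵀ = 1 := fun P => by
    have := (Matrix.mem_orthogonalGroup_iff (Fin D) ℝ).1 P.2
    simpa [Matrix.star_eq_conjTranspose] using this
  have hs : 0 < 1 / Real.sqrt D := by
    have : (0 : ℝ) < D := by exact_mod_cast hD
    positivity
  have hden := fun P : Matrix.orthogonalGroup (Fin D) ℝ => denom_lb D P (hP P) o ho
  set f : Matrix.orthogonalGroup (Fin D) ℝ → ℝ := fun P =>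
    ⟪obar0 D (P : Matrix (Fin D) (Fin D) ℝ) o, q⟫ /
          ⟪obar0 D (P : Matrix (Fin D) (Fin D) ℝ) o, o⟫ with hf
  have hmeas : Measurable f := (measurable_inner_obar0 D o q).div (measurable_inner_obar0 D o o)
  have hint : Integrable f μ := by
    refine Integrable.of_bound hmeas.aestronglyMeasurable
      ((∑ i, D * (1 / Real.sqrt D) * |q i|) / (1 / Real.sqrt D)) (Filter.Eventually.of_forall ?_)
    intro P
    rw [hf, Real.norm_eq_abs, abs_div, abs_of_pos (hs.trans_le (hden P))]
    refine div_le_div₀ (by positivity) ?_ hs (hden P)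
    rw [inner_sum']
    refine (Finset.abs_sum_le_sum_abs _ _).trans (Finset.sum_le_sum fun i _ => ?_)
    rw [abs_mul]
    exact mul_le_mul_of_nonneg_right (obar0_norm_le D P (hP P) o i) (abs_nonneg _)
  let H : Matrix.orthogonalGroup (Fin D) ℝ := ⟨refl' o, by
    rw [Matrix.mem_orthogonalGroup_iff, refl_transpose, refl_sq ho]⟩
  have hfH : ∀ P, f (H * P) = 2 * ⟪o, q⟫ - f P := by
    intro P
    have h0 := (hs.trans_le (hden P)).ne'
    simp only [hf]
    have hc : ((H * P : Matrix.orthogonalGroup (Fin D) ℝ) : Matrix (Fin D) (Fin D) ℝ)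
      = refl' o * P := rfl
    rw [hc, obar0_refl ho]
    simp only [inner_sub_left, real_inner_smul_left, real_inner_self_eq_norm_sq, ho]
    have : 2 * ⟪obar0 D (P : Matrix (Fin D) (Fin D) ℝ) o, o⟫ * 1 ^ 2
      - ⟪obar0 D (P : Matrix (Fin D) (Fin D) ℝ) o, o⟫
      = ⟪obar0 D (P : Matrix (Fin D) (Fin D) ℝ) o, o⟫ := by ring
    rw [this]
    field_simp
  have hinv : ∫ P, f (H * P) ∂μ = ∫ P, f P ∂μ := integral_mul_left_eq_self f H
  simp only [hfH] at hinv
  rw [integral_sub (integrable_const _) hint] at hinv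
  simp at hinv
  linarith
end
end

section
/- Let D ≥ 1 and B ≥ 1 be integers, let o' ∈ ℝ^D, and let ȳ ∈ 𝒢 be a cosine maximizer of o' over 𝒢 with ⟨o', ȳ⟩ > 0. Then there exists a real number t > 0 such that for all y ∈ 𝒢, ‖t·o' − ȳ‖ ≤ ‖t·o' − y‖. In particular, t = ‖ȳ‖²/⟨o', ȳ⟩ has this property. -/
open MeasureTheory
open scoped RealInnerProductSpace

noncomputable section

/-- The grid set `𝒢 ⊆ ℝ^D`: vectors whose coordinates are `−(2^B − 1)/2 + u` for an integer
`u ∈ {0, 1, ..., 2^B − 1}`. -/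
def gridSet (D B : ℕ) : Set (EuclideanSpace ℝ (Fin D)) :=
  {y | ∀ i, ∃ u : ℕ, u < 2 ^ B ∧ y i = -((2 ^ B : ℝ) - 1) / 2 + u}

/-- `ȳ ∈ 𝒢` is a cosine maximizer of `o'` over `𝒢` if `⟪ȳ/‖ȳ‖, o'⟫ ≥ ⟪y/‖y‖, o'⟫`
for all `y ∈ 𝒢`. -/
def IsCosineMaximizer (D B : ℕ) (o' ybar : EuclideanSpace ℝ (Fin D)) : Prop :=
  ybar ∈ gridSet D B ∧
    ∀ y ∈ gridSet D B, ⟪‖y‖⁻¹ • y, o'⟫ ≤ ⟪‖ybar‖⁻¹ • ybar, o'⟫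

/-- a cosine maximizer `ȳ` of `o'` over the grid `𝒢` is, after re-scaling `o'`
by some `t > 0` (in particular by `t = ‖ȳ‖²/⟨o', ȳ⟩`), a Euclidean-distance minimizer:
`‖t·o' − ȳ‖ ≤ ‖t·o' − y‖` for all `y ∈ 𝒢`. -/
theorem cosine_maximizer_is_distance_minimizer (D B : ℕ) (hD : 1 ≤ D) (hB : 1 ≤ B)
    (o' ybar : EuclideanSpace ℝ (Fin D))
    (hmax : IsCosineMaximizer D B o' ybar) (hpos : 0 < ⟪o', ybar⟫) :
    (∃ t : ℝ, 0 < t ∧ ∀ y ∈ gridSet D B, ‖t • o' - ybar‖ ≤ ‖t • o' - y‖) ∧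
      ∀ y ∈ gridSet D B,
        ‖(‖ybar‖ ^ 2 / ⟪o', ybar⟫) • o' - ybar‖ ≤ ‖(‖ybar‖ ^ 2 / ⟪o', ybar⟫) • o' - y‖ := by
  have hp0 : ybar ≠ 0 := by
    rintro rfl
    simp at hpos
  have ha : 0 < ‖ybar‖ := norm_pos_iff.mpr hp0
  have key : ∀ y ∈ gridSet D B,
      ‖(‖ybar‖ ^ 2 / ⟪o', ybar⟫) • o' - ybar‖ ≤ ‖(‖ybar‖ ^ 2 / ⟪o', ybar⟫) • o' - y‖ := by
    intro y hy
    have h := hmax.2 y hy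
    rw [real_inner_smul_left, real_inner_smul_left, real_inner_comm, real_inner_comm o' ybar] at h
    have hq : ⟪o', y⟫ * ‖ybar‖ ≤ ⟪o', ybar⟫ * ‖y‖ := by
      by_cases hy0 : y = 0
      · simp [hy0]
      · have hb : 0 < ‖y‖ := norm_pos_iff.mpr hy0
        rw [inv_mul_eq_div, inv_mul_eq_div, div_le_div_iff₀ hb ha] at h
        exact h
    refine (sq_le_sq₀ (norm_nonneg _) (norm_nonneg _)).mp ?_
    rw [norm_sub_sq_real, norm_sub_sq_real, real_inner_smul_left, real_inner_smul_left]
    have h1 : ‖ybar‖ ^ 2 / ⟪o', ybar⟫ * ⟪o', ybar⟫ = ‖ybar‖ ^ 2 := by field_simp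
    have h2 : ‖ybar‖ ^ 2 / ⟪o', ybar⟫ * ⟪o', y⟫ ≤ ‖ybar‖ * ‖y‖ := by
      rw [div_mul_eq_mul_div, div_le_iff₀ hpos]
      nlinarith
    nlinarith [sq_nonneg (‖ybar‖ - ‖y‖)]
  exact ⟨⟨_, by positivity, key⟩, key⟩
end
end

section
/- Let o', ȳ, y ∈ ℝ^D with ȳ ≠ 0, y ≠ 0, ⟨o', ȳ/‖ȳ‖⟩ ≥ ⟨o', y/‖y‖⟩, and ⟨o', ȳ⟩ > 0. Set t := ‖ȳ‖²/⟨o', ȳ⟩. Then ‖y − t·o'‖² − ‖ȳ − t·o'‖² ≥ (‖ȳ‖ − ‖y‖)² ≥ 0; in particular ‖t·o' − ȳ‖ ≤ ‖t·o' − y‖. -/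
open scoped RealInnerProductSpace

/-- the core re-scaling inequality. If `⟨o', ȳ/‖ȳ‖⟩ ≥ ⟨o', y/‖y‖⟩` and
`⟨o', ȳ⟩ > 0`, then with `t = ‖ȳ‖²/⟨o', ȳ⟩` one has
`‖y − t·o'‖² − ‖ȳ − t·o'‖² ≥ (‖ȳ‖ − ‖y‖)² ≥ 0`, hence `‖t·o' − ȳ‖ ≤ ‖t·o' − y‖`. -/
theorem rescaling_inequality (D : ℕ) (o' ybar y : EuclideanSpace ℝ (Fin D))
    (hybar : ybar ≠ 0) (hy : y ≠ 0)
    (hcos : ⟪o', ‖y‖⁻¹ • y⟫ ≤ ⟪o', ‖ybar‖⁻¹ • ybar⟫)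
    (hpos : 0 < ⟪o', ybar⟫) :
    (‖ybar‖ - ‖y‖) ^ 2 ≤
        ‖y - (‖ybar‖ ^ 2 / ⟪o', ybar⟫) • o'‖ ^ 2 -
          ‖ybar - (‖ybar‖ ^ 2 / ⟪o', ybar⟫) • o'‖ ^ 2 ∧
      ‖(‖ybar‖ ^ 2 / ⟪o', ybar⟫) • o' - ybar‖ ≤ ‖(‖ybar‖ ^ 2 / ⟪o', ybar⟫) • o' - y‖ := by
  have hb : 0 < ‖ybar‖ := norm_pos_iff.mpr hybar
  have hn : 0 < ‖y‖ := norm_pos_iff.mpr hy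
  rw [real_inner_smul_right, real_inner_smul_right] at hcos
  set t : ℝ := ‖ybar‖ ^ 2 / ⟪o', ybar⟫ with ht
  have htpos : 0 < t := by positivity
  have hts : t * ⟪o', ybar⟫ = ‖ybar‖ ^ 2 := by
    rw [ht]; field_simp
  have hkey : t * ⟪o', y⟫ ≤ ‖ybar‖ * ‖y‖ := by
    have h1 := mul_le_mul_of_nonneg_left hcos (mul_pos htpos hn).le
    have h2 : t * ‖y‖ * (‖y‖⁻¹ * ⟪o', y⟫) = t * ⟪o', y⟫ := by
      field_simp
    have h3 : t * ‖y‖ * (‖ybar‖⁻¹ * ⟪o', ybar⟫) = ‖ybar‖ * ‖y‖ := by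
      have : t * ‖y‖ * (‖ybar‖⁻¹ * ⟪o', ybar⟫) = (t * ⟪o', ybar⟫) * ‖y‖ * ‖ybar‖⁻¹ := by ring
      rw [this, hts]; field_simp
    rwa [h2, h3] at h1
  have hmain : (‖ybar‖ - ‖y‖) ^ 2 ≤ ‖y - t • o'‖ ^ 2 - ‖ybar - t • o'‖ ^ 2 := by
    rw [norm_sub_sq_real, norm_sub_sq_real, real_inner_smul_right, real_inner_smul_right,
      real_inner_comm o' y, real_inner_comm o' ybar, hts]
    nlinarith
  refine ⟨hmain, ?_⟩
  rw [norm_sub_rev _ ybar, norm_sub_rev _ y]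
  refine (sq_le_sq₀ (norm_nonneg _) (norm_nonneg _)).mp ?_
  linarith [sq_nonneg (‖ybar‖ - ‖y‖)]
end

section
/- Let D ≥ 1 and B ≥ 1 be integers, let o' ∈ ℝ^D be a unit vector, and let ȳ ∈ 𝒢 be a cosine maximizer of o' over 𝒢 with ⟨o', ȳ⟩ > 0. Then √(1 − ⟨o', ȳ/‖ȳ‖⟩²) = inf { ‖o' − t·y‖ : t > 0, y ∈ 𝒢 }, and the infimum is attained at y = ȳ and t = ⟨o', ȳ/‖ȳ‖⟩ / ‖ȳ‖. (Equivalently, for an orthogonal matrix P, a unit vector o with o' = P⁻¹ o, and the quantized vector ō = P ȳ/‖ȳ‖, one has √(1 − ⟨o, ō⟩²) = min_{t>0, y∈𝒢} ‖o' − t y‖.) -/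
open MeasureTheory
open scoped RealInnerProductSpace

noncomputable section

/-- for a unit vector `o'` and a cosine maximizer `ȳ` of `o'` over `𝒢` with
`⟨o', ȳ⟩ > 0`, one has `√(1 − ⟨o', ȳ/‖ȳ‖⟩²) = inf {‖o' − t·y‖ : t > 0, y ∈ 𝒢}`, and the
infimum is attained at `y = ȳ`, `t = ⟨o', ȳ/‖ȳ‖⟩/‖ȳ‖`. -/
theorem sqrt_one_sub_cosine_sq_eq_inf (D B : ℕ) (hD : 1 ≤ D) (hB : 1 ≤ B)
    (o' ybar : EuclideanSpace ℝ (Fin D)) (ho' : ‖o'‖ = 1)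
    (hmax : IsCosineMaximizer D B o' ybar) (hpos : 0 < ⟪o', ybar⟫) :
    Real.sqrt (1 - ⟪o', ‖ybar‖⁻¹ • ybar⟫ ^ 2)
        = sInf {r : ℝ | ∃ t : ℝ, 0 < t ∧ ∃ y ∈ gridSet D B, r = ‖o' - t • y‖} ∧
      ‖o' - (⟪o', ‖ybar‖⁻¹ • ybar⟫ / ‖ybar‖) • ybar‖
        = Real.sqrt (1 - ⟪o', ‖ybar‖⁻¹ • ybar⟫ ^ 2) := by
  have hy0 : ybar ≠ 0 := by
    rintro rfl
    simp at hpos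
  have hn : 0 < ‖ybar‖ := norm_pos_iff.mpr hy0
  obtain ⟨hmem, hle⟩ := hmax
  have hexp : ∀ (t : ℝ) (y : EuclideanSpace ℝ (Fin D)),
      ‖o' - t • y‖ ^ 2 = 1 - 2 * (t * ⟪o', y⟫) + t ^ 2 * ‖y‖ ^ 2 := by
    intro t y
    rw [norm_sub_sq_real, ho', real_inner_smul_right, norm_smul, mul_pow, Real.norm_eq_abs,
      sq_abs]
    ring
  have hcdef : ⟪o', ‖ybar‖⁻¹ • ybar⟫ = ‖ybar‖⁻¹ * ⟪o', ybar⟫ := real_inner_smul_right _ _ _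
  have hle' : ∀ y ∈ gridSet D B, ⟪o', y⟫ ≤ ‖y‖ * ⟪o', ‖ybar‖⁻¹ • ybar⟫ := by
    intro y hy
    by_cases h0 : y = 0
    · simp [h0]
    have hny : 0 < ‖y‖ := norm_pos_iff.mpr h0
    have h := hle y hy
    rw [real_inner_comm, real_inner_comm o' (‖ybar‖⁻¹ • ybar), real_inner_smul_right] at h
    have h2 := mul_le_mul_of_nonneg_left h hny.le
    rwa [← mul_assoc, mul_inv_cancel₀ hny.ne', one_mul] at h2
  have hcpos : 0 < ⟪o', ‖ybar‖⁻¹ • ybar⟫ := by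
    rw [hcdef]; positivity
  have hin : ⟪o', ybar⟫ = ‖ybar‖ * ⟪o', ‖ybar‖⁻¹ • ybar⟫ := by
    rw [hcdef]; field_simp
  generalize ⟪o', ‖ybar‖⁻¹ • ybar⟫ = c at *
  have hatt : ‖o' - (c / ‖ybar‖) • ybar‖ = Real.sqrt (1 - c ^ 2) := by
    rw [← Real.sqrt_sq (norm_nonneg (o' - (c / ‖ybar‖) • ybar)), hexp, hin]
    congr 1
    field_simp
    ring
  refine ⟨?_, hatt⟩
  symm
  apply IsLeast.csInf_eq
  refine ⟨⟨c / ‖ybar‖, div_pos hcpos hn, ybar, hmem, hatt.symm⟩, ?_⟩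
  rintro r ⟨t, ht, y, hy, rfl⟩
  apply Real.sqrt_le_iff.mpr
  refine ⟨norm_nonneg _, ?_⟩
  rw [hexp]
  have h := mul_le_mul_of_nonneg_left (hle' y hy) ht.le
  nlinarith [sq_nonneg (t * ‖y‖ - c)]
end
end

section
/- Let D ≥ 1 and B ≥ 1 be integers, let o' ∈ ℝ^D be a unit vector, and let ȳ ∈ 𝒢 be a cosine maximizer of o' over 𝒢. Then for all t > 0 and all y ∈ 𝒢, ‖o' − t·y‖² ≥ 1 − ⟨o', ȳ/‖ȳ‖⟩². (The proof uses that 𝒢 is symmetric: y ∈ 𝒢 if and only if −y ∈ 𝒢.) -/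
open MeasureTheory
open scoped RealInnerProductSpace

noncomputable section

/-- for a unit vector `o'` and a cosine maximizer `ȳ` of `o'` over `𝒢`,
for all `t > 0` and `y ∈ 𝒢`, `‖o' − t·y‖² ≥ 1 − ⟨o', ȳ/‖ȳ‖⟩²`. -/
theorem dist_sq_ge_one_sub_cosine_sq (D B : ℕ) (hD : 1 ≤ D) (hB : 1 ≤ B)
    (o' ybar : EuclideanSpace ℝ (Fin D)) (ho' : ‖o'‖ = 1)
    (hmax : IsCosineMaximizer D B o' ybar) :
    ∀ t : ℝ, 0 < t → ∀ y ∈ gridSet D B,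
      1 - ⟪o', ‖ybar‖⁻¹ • ybar⟫ ^ 2 ≤ ‖o' - t • y‖ ^ 2 := by
  intro t ht y hy
  have hneg : -y ∈ gridSet D B := by
    intro i
    obtain ⟨u, hu, hyi⟩ := hy i
    refine ⟨2 ^ B - 1 - u, by omega, ?_⟩
    have h1 : ((2 ^ B - 1 - u : ℕ) : ℝ) = (2 ^ B : ℝ) - 1 - u := by
      rw [Nat.sub_sub, Nat.cast_sub (by omega)]
      push_cast
      ring
    rw [h1]
    simp only [PiLp.neg_apply, hyi]
    ring
  have h1 := hmax.2 y hy
  have h2 := hmax.2 (-y) hneg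
  rw [real_inner_comm o' (‖ybar‖⁻¹ • ybar)] at h1 h2
  generalize ⟪o', ‖ybar‖⁻¹ • ybar⟫ = C at h1 h2 ⊢
  rw [norm_neg, smul_neg, inner_neg_left] at h2
  have h3 : ⟪o', y⟫ = ‖y‖ * ⟪‖y‖⁻¹ • y, o'⟫ := by
    rw [real_inner_smul_left, real_inner_comm]
    by_cases h : y = 0
    · simp [h]
    · have := norm_ne_zero_iff.2 h
      field_simp
  generalize ⟪‖y‖⁻¹ • y, o'⟫ = c at h1 h2 h3
  rw [norm_sub_sq_real, ho', real_inner_smul_right, h3, norm_smul, Real.norm_of_nonneg ht.le]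
  nlinarith [sq_nonneg (t * ‖y‖ - c), mul_nonneg (sub_nonneg.2 h1) (sub_nonneg.2 h2)]
end
end

section
/- Let X be a real-valued random variable, let D ≥ 1 be an integer and c₀ > 0 a real number, and suppose that ℙ{ |X| > t/√D } ≤ 2·exp(−c₀ t²) for all t > 0. Then for every L ≥ 0, E[ (max(|X| − L/√D, 0))² ] ≤ (2/(c₀ D)) · exp(−c₀ L²). -/
open MeasureTheory

/-- if a random variable `X` satisfies the sub-Gaussian tail bound
`ℙ{|X| > t/√D} ≤ 2·exp(−c₀ t²)` for all `t > 0`, then for every `L ≥ 0`,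
`E[(max(|X| − L/√D, 0))²] ≤ (2/(c₀ D))·exp(−c₀ L²)`. -/
theorem clipped_excess_sq_expectation_bound {Ω : Type*} [MeasurableSpace Ω]
    (μ : Measure Ω) [IsProbabilityMeasure μ] (X : Ω → ℝ) (hX : Measurable X)
    (D : ℕ) (hD : 1 ≤ D) (c₀ : ℝ) (hc₀ : 0 < c₀)
    (htail : ∀ t : ℝ, 0 < t →
      μ {ω | t / Real.sqrt D < |X ω|} ≤ ENNReal.ofReal (2 * Real.exp (-c₀ * t ^ 2)))
    (L : ℝ) (hL : 0 ≤ L) :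
    ∫⁻ ω, ENNReal.ofReal (max (|X ω| - L / Real.sqrt D) 0 ^ 2) ∂μ
      ≤ ENNReal.ofReal (2 / (c₀ * D) * Real.exp (-c₀ * L ^ 2)) := by
  have hDpos : (0 : ℝ) < D := by exact_mod_cast hD
  have hsD : 0 < Real.sqrt D := Real.sqrt_pos.2 hDpos
  have hneg : -(c₀ * D) < 0 := by
    have := mul_pos hc₀ hDpos
    linarith
  rw [lintegral_eq_lintegral_meas_lt μ (Filter.Eventually.of_forall fun ω => by positivity)
    (by fun_prop)]
  have hpt : ∀ s ∈ Set.Ioi (0 : ℝ),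
      μ {ω | s < max (|X ω| - L / Real.sqrt D) 0 ^ 2} ≤
        ENNReal.ofReal (2 * Real.exp (-c₀ * L ^ 2) * Real.exp (-(c₀ * D) * s)) := by
    intro s hs
    have hs0 : 0 < s := hs
    have hrs : 0 < Real.sqrt s := Real.sqrt_pos.2 hs0
    have ht : 0 < Real.sqrt s * Real.sqrt D + L := by positivity
    refine (measure_mono ?_).trans ((htail _ ht).trans ?_)
    · intro ω hω
      simp only [Set.mem_setOf_eq] at hω ⊢
      have h1 : Real.sqrt s < max (|X ω| - L / Real.sqrt D) 0 :=
        (Real.sqrt_lt' (by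
          rcases (le_max_right (|X ω| - L / Real.sqrt D) 0).lt_or_eq with h | h
          · exact h
          · rw [← h] at hω
            norm_num at hω
            linarith)).2 hω
      have h2 : Real.sqrt s < |X ω| - L / Real.sqrt D := by
        rcases lt_max_iff.1 h1 with h | h
        · exact h
        · linarith
      rw [add_div, mul_div_assoc, div_self hsD.ne', mul_one]
      linarith
    · apply ENNReal.ofReal_le_ofReal
      rw [mul_assoc, ← Real.exp_add]
      have e : (Real.sqrt s * Real.sqrt D + L) ^ 2
          = s * D + 2 * (Real.sqrt s * Real.sqrt D * L) + L ^ 2 := by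
        have a := Real.sq_sqrt hs0.le
        have b := Real.sq_sqrt hDpos.le
        rw [add_sq, mul_pow, a, b]
        ring
      have hp : 0 ≤ c₀ * (Real.sqrt s * Real.sqrt D * L) := by positivity
      gcongr
      rw [e]
      nlinarith
  refine (setLIntegral_mono' measurableSet_Ioi hpt).trans ?_
  rw [← ofReal_integral_eq_lintegral_ofReal ((integrableOn_exp_mul_Ioi hneg 0).const_mul _)
    (Filter.Eventually.of_forall fun s => by positivity)]
  apply ENNReal.ofReal_le_ofReal
  rw [integral_const_mul, integral_exp_mul_Ioi hneg]
  apply le_of_eq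
  simp only [mul_zero, Real.exp_zero]
  field_simp
end

section
/- There exists an absolute constant c₀ > 0 such that the following holds for every integer D ≥ 1 and every real L > 0. Let o' be a random vector distributed according to the uniform (rotation-invariant) probability measure on the unit sphere S^{D−1} = {x ∈ ℝ^D : ‖x‖ = 1}, and define the coordinatewise clipping map f : ℝ → ℝ by f(x) = sgn(x) · min(|x|, L/√D), applied to each coordinate of o'. Then E[ ‖o' − f(o')‖² ] ≤ (2/c₀) · exp(−c₀ L²), where ‖·‖ is the Euclidean norm and f(o') denotes the vector whose i-th coordinate is f(o'[i]). -/
open MeasureTheory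

noncomputable section

/-- Coordinatewise clipping map: `f(x) = sgn(x) · min(|x|, L/√D)` applied to each coordinate,
with `sgn(x) = −1` for `x < 0` and `sgn(x) = +1` for `x ≥ 0`. -/
def clip (D : ℕ) (L : ℝ) (x : EuclideanSpace ℝ (Fin D)) : EuclideanSpace ℝ (Fin D) :=
  (WithLp.equiv 2 (Fin D → ℝ)).symm fun i =>
    (if x i < 0 then (-1 : ℝ) else 1) * min |x i| (L / Real.sqrt D)

theorem aux_integrable {D : ℕ} (μ : Measure (EuclideanSpace ℝ (Fin D)))
    [IsProbabilityMeasure μ] (hs : ∀ᵐ x ∂μ, ‖x‖ = 1)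
    (f : EuclideanSpace ℝ (Fin D) → ℝ) (hf : Continuous f) : Integrable f μ := by
  obtain ⟨C, hC⟩ := (isCompact_sphere (0 : EuclideanSpace ℝ (Fin D)) 1).exists_bound_of_continuousOn
    hf.continuousOn
  refine Integrable.of_bound hf.aestronglyMeasurable C ?_
  filter_upwards [hs] with x hx
  exact hC x (by simpa using hx)

theorem aux_coord {D : ℕ} (x : EuclideanSpace ℝ (Fin D)) (hx : ‖x‖ = 1) (i : Fin D) :
    |x i| ≤ 1 := by
  have := PiLp.norm_apply_le x i
  rwa [hx, Real.norm_eq_abs] at this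

theorem aux_refl {D : ℕ} (i j : Fin D) (hij : i ≠ j) (p : ℝ) :
    ∃ T : EuclideanSpace ℝ (Fin D) ≃ₗᵢ[ℝ] EuclideanSpace ℝ (Fin D), ∀ x,
      T x i = Real.cos p * x i + Real.sin p * x j ∧
      T x j = Real.sin p * x i - Real.cos p * x j := by
  set v : EuclideanSpace ℝ (Fin D) := Real.cos (p/2) • EuclideanSpace.single i (1:ℝ) +
    Real.sin (p/2) • EuclideanSpace.single j (1:ℝ) with hv
  have hvi : v i = Real.cos (p/2) := by simp [hv, hij]
  have hvj : v j = Real.sin (p/2) := by simp [hv, hij.symm]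
  have hin : ∀ x : EuclideanSpace ℝ (Fin D), inner ℝ v x =
      Real.cos (p/2) * x i + Real.sin (p/2) * x j := by
    intro x
    simp [hv, inner_add_left, inner_smul_left, EuclideanSpace.inner_single_left]
  have hn : ‖v‖ ^ 2 = 1 := by
    rw [← real_inner_self_eq_norm_sq, hin, hvi, hvj]
    nlinarith [Real.sin_sq_add_cos_sq (p/2)]
  have hc : Real.cos p = 2 * Real.cos (p/2)^2 - 1 := by
    rw [← Real.cos_two_mul]; congr 1; ring
  have hsn : Real.sin p = 2 * Real.sin (p/2) * Real.cos (p/2) := by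
    rw [← Real.sin_two_mul]; congr 1; ring
  have h1 := Real.sin_sq_add_cos_sq (p/2)
  refine ⟨(Submodule.span ℝ {v}).reflection, fun x => ?_⟩
  rw [Submodule.reflection_singleton_apply]
  simp only [hin, PiLp.sub_apply, PiLp.smul_apply, smul_eq_mul, hvi, hvj, hn, hc, hsn]
  simp [hvi, hvj, hn]
  constructor
  · ring
  · linear_combination (2 * x j) * h1

theorem aux_ibp {D : ℕ} (μ : Measure (EuclideanSpace ℝ (Fin D)))
    [IsProbabilityMeasure μ] (hs : ∀ᵐ x ∂μ, ‖x‖ = 1)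
    (hT : ∀ T : EuclideanSpace ℝ (Fin D) ≃ₗᵢ[ℝ] EuclideanSpace ℝ (Fin D), μ.map T = μ)
    (a : ℝ) (ha : 0 ≤ a) (i j : Fin D) (hij : i ≠ j) :
    ∫ x, (x i ^ 2 - x j ^ 2 - 2 * a * x i ^ 2 * x j ^ 2) * Real.exp (a * x i ^ 2) ∂μ = 0 := by
  let u : ℝ → EuclideanSpace ℝ (Fin D) → ℝ := fun p x => Real.cos p * x i + Real.sin p * x j
  let v : ℝ → EuclideanSpace ℝ (Fin D) → ℝ := fun p x => Real.sin p * x i - Real.cos p * x j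
  let F : ℝ → EuclideanSpace ℝ (Fin D) → ℝ := fun p x =>
    u p x * v p x * Real.exp (a * u p x ^ 2)
  let F' : ℝ → EuclideanSpace ℝ (Fin D) → ℝ := fun p x =>
    (u p x ^ 2 - v p x ^ 2 - 2 * a * u p x ^ 2 * v p x ^ 2) * Real.exp (a * u p x ^ 2)
  have hFc : ∀ p, Continuous (F p) := fun p => by
    simp only [F, u, v]; fun_prop
  have hFc' : ∀ p, Continuous (F' p) := fun p => by
    simp only [F', u, v]; fun_prop
  have hd : ∀ x p, HasDerivAt (fun q => F q x) (F' p x) p := by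
    intro x p
    have hu : HasDerivAt (fun q => u q x) (- v p x) p := by
      have := ((Real.hasDerivAt_cos p).mul_const (x i)).add
        ((Real.hasDerivAt_sin p).mul_const (x j))
      refine this.congr_deriv ?_
      simp only [v]; ring
    have hv : HasDerivAt (fun q => v q x) (u p x) p := by
      have := ((Real.hasDerivAt_sin p).mul_const (x i)).sub
        ((Real.hasDerivAt_cos p).mul_const (x j))
      refine this.congr_deriv ?_
      simp only [u]; ring
    have he := ((hu.pow 2).const_mul a).exp
    have := (hu.mul hv).mul he
    refine this.congr_deriv ?_
    simp only [F', Pi.mul_apply, Pi.pow_apply]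
    push_cast
    ring
  have hconst : ∀ p, ∫ x, F p x ∂μ = ∫ x, x i * x j * Real.exp (a * x i ^ 2) ∂μ := by
    intro p
    obtain ⟨T, hTx⟩ := aux_refl i j hij p
    conv_rhs => rw [← hT T]
    rw [integral_map T.continuous.aemeasurable]
    · simp only [hTx]; rfl
    · exact Continuous.aestronglyMeasurable (by fun_prop)
  have key := hasDerivAt_integral_of_dominated_loc_of_deriv_le (μ := μ) (F := F) (F' := F')
    (x₀ := (0:ℝ)) (s := Set.univ) (bound := fun _ => (4 + 4 + 2 * a * 4 * 4) * Real.exp (a * 4))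
    Filter.univ_mem (Filter.Eventually.of_forall fun p => (hFc p).aestronglyMeasurable)
    (aux_integrable μ hs _ (hFc 0)) (hFc' 0).aestronglyMeasurable
    (by
      filter_upwards [hs] with x hx p _
      have hi := aux_coord x hx i
      have hj := aux_coord x hx j
      have hb : ∀ s t y z : ℝ, |s| ≤ 1 → |t| ≤ 1 → |y| ≤ 1 → |z| ≤ 1 →
          (s * y + t * z) ^ 2 ≤ 4 := by
        intro s t y z h1 h2 h3 h4
        have h5 : |s * y| ≤ 1 := by
          rw [abs_mul]; exact mul_le_one₀ h1 (abs_nonneg _) h3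
        have h6 : |t * z| ≤ 1 := by
          rw [abs_mul]; exact mul_le_one₀ h2 (abs_nonneg _) h4
        rw [abs_le] at h5 h6
        nlinarith
      have hub : u p x ^ 2 ≤ 4 := hb _ _ _ _ (Real.abs_cos_le_one p) (Real.abs_sin_le_one p) hi hj
      have hvb : v p x ^ 2 ≤ 4 := by
        have := hb (Real.sin p) (-Real.cos p) (x i) (x j) (Real.abs_sin_le_one p)
          (by rw [abs_neg]; exact Real.abs_cos_le_one p) hi hj
        simp only [v]
        convert this using 2
        ring
      have hu0 := sq_nonneg (u p x)
      have hv0 := sq_nonneg (v p x)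
      have huv : a * (u p x ^ 2 * v p x ^ 2) ≤ a * (4 * 4) := by gcongr
      have huv0 : 0 ≤ a * (u p x ^ 2 * v p x ^ 2) := by positivity
      rw [Real.norm_eq_abs]
      simp only [F']
      rw [abs_mul, abs_of_pos (Real.exp_pos _)]
      gcongr
      rw [abs_le]
      constructor <;> nlinarith)
    (integrable_const _) (Filter.Eventually.of_forall fun x p _ => hd x p)
  have h0 := key.2
  simp only [hconst] at h0
  have := h0.unique (hasDerivAt_const _ _)
  simpa [F', u, v] using this

theorem aux_moment {D : ℕ} (μ : Measure (EuclideanSpace ℝ (Fin D)))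
    [IsProbabilityMeasure μ] (hs : ∀ᵐ x ∂μ, ‖x‖ = 1)
    (hT : ∀ T : EuclideanSpace ℝ (Fin D) ≃ₗᵢ[ℝ] EuclideanSpace ℝ (Fin D), μ.map T = μ)
    (i : Fin D) :
    D * ∫ x, x i ^ 2 * Real.exp (D / 4 * x i ^ 2) ∂μ ≤ 4 := by
  set a : ℝ := D / 4 with hadef
  have ha : 0 ≤ a := by positivity
  have hsum : ∫ x, ∑ j, (if i = j then 0 else
      (x i ^ 2 - x j ^ 2 - 2 * a * x i ^ 2 * x j ^ 2) * Real.exp (a * x i ^ 2)) ∂μ = 0 := by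
    rw [integral_finsetSum]
    · apply Finset.sum_eq_zero
      intro j _
      by_cases h : i = j
      · simp [h]
      · simpa [h] using aux_ibp μ hs hT a ha i j h
    · intro j _
      apply aux_integrable μ hs
      by_cases h : i = j
      · simp [h]; fun_prop
      · simp [h]; fun_prop
  have hint : ∀ f : EuclideanSpace ℝ (Fin D) → ℝ, Continuous f → Integrable f μ :=
    aux_integrable μ hs
  have hle : ∫ x, (D - 3 * a) * (x i ^ 2 * Real.exp (a * x i ^ 2)) - 1 ∂μ ≤
      ∫ x, ∑ j, (if i = j then 0 else
      (x i ^ 2 - x j ^ 2 - 2 * a * x i ^ 2 * x j ^ 2) * Real.exp (a * x i ^ 2)) ∂μ := by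
    apply integral_mono_ae
    · exact hint _ (by fun_prop)
    · apply hint
      apply continuous_finsetSum
      intro j _
      by_cases h : i = j
      · simp [h]; fun_prop
      · simp [h]; fun_prop
    · filter_upwards [hs] with x hx
      have hn : ∑ j, x j ^ 2 = 1 := by
        have := EuclideanSpace.real_norm_sq_eq x
        rw [hx] at this; linarith
      have e1 : ∑ j, (if i = j then 0 else
          (x i ^ 2 - x j ^ 2 - 2 * a * x i ^ 2 * x j ^ 2) * Real.exp (a * x i ^ 2)) =
          ∑ j, ((x i ^ 2 - x j ^ 2 - 2 * a * x i ^ 2 * x j ^ 2) * Real.exp (a * x i ^ 2)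
            + if i = j then 2 * a * x i ^ 2 * x i ^ 2 * Real.exp (a * x i ^ 2) else 0) := by
        apply Finset.sum_congr rfl
        intro j _
        by_cases h : i = j
        · subst h; simp
        · simp [h]
      have e2 : ∑ j, (x i ^ 2 - x j ^ 2 - 2 * a * x i ^ 2 * x j ^ 2)
          = D * x i ^ 2 - 1 - 2 * a * x i ^ 2 := by
        rw [Finset.sum_sub_distrib, Finset.sum_sub_distrib, ← Finset.mul_sum, hn]
        simp
      rw [e1, Finset.sum_add_distrib, ← Finset.sum_mul, e2]
      simp only [Finset.sum_ite_eq, Finset.mem_univ, if_true]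
      have h1 : 0 ≤ 2 * a * x i ^ 2 * x i ^ 2 * Real.exp (a * x i ^ 2) := by positivity
      have h2 : Real.exp (a * x i ^ 2) ≤ 1 + a * x i ^ 2 * Real.exp (a * x i ^ 2) := by
        have h3 := Real.add_one_le_exp (-(a * x i ^ 2))
        have h4 : Real.exp (-(a * x i ^ 2)) * Real.exp (a * x i ^ 2) = 1 := by
          rw [← Real.exp_add]; simp
        nlinarith [Real.exp_pos (a * x i ^ 2)]
      nlinarith
  rw [hsum, integral_sub (hint _ (by fun_prop)) (integrable_const _), integral_const_mul] at hle
  simp only [integral_const, probReal_univ, smul_eq_mul, one_mul] at hle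
  have : (D : ℝ) - 3 * a = D / 4 := by rw [hadef]; ring
  rw [this] at hle
  linarith

theorem aux_point (D : ℕ) (hD : 1 ≤ D) (L : ℝ) (hL : 0 < L) (y : ℝ) :
    (y - (if y < 0 then (-1 : ℝ) else 1) * min |y| (L / Real.sqrt D)) ^ 2 ≤
      y ^ 2 * Real.exp (D / 4 * y ^ 2) * Real.exp (-(1/4) * L ^ 2) := by
  have hD' : (0:ℝ) < D := by exact_mod_cast hD
  set t := L / Real.sqrt D with ht
  have ht0 : 0 < t := by positivity
  have ht2 : D * t ^ 2 = L ^ 2 := by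
    rw [ht, div_pow, Real.sq_sqrt hD'.le]; field_simp
  rcases le_total |y| t with h | h
  · rw [min_eq_left h]
    have : y - (if y < 0 then (-1 : ℝ) else 1) * |y| = 0 := by
      split_ifs with h0
      · rw [abs_of_neg h0]; ring
      · rw [abs_of_nonneg (not_lt.mp h0)]; ring
    rw [this, zero_pow two_ne_zero]; positivity
  · rw [min_eq_right h]
    have h1 : (y - (if y < 0 then (-1 : ℝ) else 1) * t) ^ 2 ≤ y ^ 2 := by
      split_ifs with h0
      · rw [abs_of_neg h0] at h; nlinarith
      · rw [abs_of_nonneg (not_lt.mp h0)] at h; nlinarith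
    refine h1.trans ?_
    rw [mul_assoc, ← Real.exp_add]
    have h2 : t ^ 2 ≤ y ^ 2 := by
      rw [← sq_abs y]; gcongr
    have h3 : 0 ≤ (D:ℝ) / 4 * y ^ 2 + -(1/4) * L ^ 2 := by
      rw [← ht2]; nlinarith
    exact le_mul_of_one_le_right (sq_nonneg _) (Real.one_le_exp h3)

/-- there is an absolute constant `c₀ > 0` such that for `o'` uniformly
distributed on the unit sphere `S^{D−1}` and every `L > 0`,
`E[‖o' − f(o')‖²] ≤ (2/c₀)·exp(−c₀ L²)` where `f` is the coordinatewise clipping at `L/√D`. -/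
theorem expected_clipping_error_bound :
    ∃ c₀ : ℝ, 0 < c₀ ∧
      ∀ (D : ℕ), 1 ≤ D → ∀ (L : ℝ), 0 < L →
      ∀ (μ : Measure (EuclideanSpace ℝ (Fin D))),
        IsProbabilityMeasure μ →
        (∀ᵐ x ∂μ, ‖x‖ = 1) →
        (∀ T : EuclideanSpace ℝ (Fin D) ≃ₗᵢ[ℝ] EuclideanSpace ℝ (Fin D), μ.map T = μ) →
        ∫ x, ‖x - clip D L x‖ ^ 2 ∂μ ≤ 2 / c₀ * Real.exp (-c₀ * L ^ 2) := by
  refine ⟨1/4, by norm_num, ?_⟩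
  intro D hD L hL μ hμ hs hT
  have hD' : (0:ℝ) < D := by exact_mod_cast hD
  have hint : ∀ i : Fin D, Integrable (fun x : EuclideanSpace ℝ (Fin D) =>
      x i ^ 2 * Real.exp (D / 4 * x i ^ 2)) μ :=
    fun i => aux_integrable μ hs _ (by fun_prop)
  have h1 : ∫ x, ‖x - clip D L x‖ ^ 2 ∂μ ≤
      ∫ x, (∑ i, x i ^ 2 * Real.exp (D / 4 * x i ^ 2)) * Real.exp (-(1/4) * L ^ 2) ∂μ := by
    apply integral_mono_of_nonneg
    · exact Filter.Eventually.of_forall fun x => by positivity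
    · exact (integrable_finsetSum _ fun i _ => hint i).mul_const _
    · refine Filter.Eventually.of_forall fun x => ?_
      simp only
      rw [EuclideanSpace.real_norm_sq_eq, Finset.sum_mul]
      apply Finset.sum_le_sum
      intro i _
      exact aux_point D hD L hL (x i)
  refine h1.trans ?_
  rw [integral_mul_const, integral_finsetSum _ fun i _ => hint i]
  gcongr
  calc ∑ i, ∫ x, x i ^ 2 * Real.exp (D / 4 * x i ^ 2) ∂μ ≤ ∑ i : Fin D, (4 / D : ℝ) := by
        apply Finset.sum_le_sum
        intro i _
        rw [le_div_iff₀ hD', mul_comm]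
        exact aux_moment μ hs hT i
    _ = 4 := by simp; field_simp
    _ ≤ 2 / (1/4) := by norm_num
end
end

section
/- Let D ≥ 1 and B ≥ 1 be integers and L > 0 a real number. Let v ∈ ℝ^D satisfy |v[i]| ≤ L/√D for every coordinate i, and set t₀ := L/(2^{B−1}·√D). Then there exists y ∈ 𝒢 such that |v[i] − t₀·y[i]| ≤ L/(2^B·√D) for every i, and consequently ‖v − t₀·y‖ ≤ L/2^B. -/
open MeasureTheory
open scoped RealInnerProductSpace

noncomputable section

theorem exists_cell (n : ℕ) (hn : 1 ≤ n) (w : ℝ) (h0 : 0 ≤ w) (h1 : w ≤ n) :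
    ∃ u : ℕ, u < n ∧ (u : ℝ) ≤ w ∧ w ≤ u + 1 := by
  rcases h1.lt_or_eq with h | h
  · exact ⟨⌊w⌋₊, (Nat.floor_lt h0).2 h, Nat.floor_le h0, (Nat.lt_floor_add_one w).le⟩
  · obtain ⟨m, rfl⟩ : ∃ m, n = m + 1 := ⟨n - 1, by omega⟩
    push_cast at h
    exact ⟨m, by omega, by linarith, by linarith⟩

/-- if every coordinate of `v` satisfies `|v i| ≤ L/√D`, then with
`t₀ = L/(2^{B−1}·√D)` there is a grid vector `y ∈ 𝒢` with `|v i − t₀·y i| ≤ L/(2^B·√D)`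
for every `i`, and consequently `‖v − t₀·y‖ ≤ L/2^B`. -/
theorem grid_rounding_error_bound (D B : ℕ) (hD : 1 ≤ D) (hB : 1 ≤ B)
    (L : ℝ) (hL : 0 < L) (v : EuclideanSpace ℝ (Fin D))
    (hv : ∀ i, |v i| ≤ L / Real.sqrt D) :
    ∃ y ∈ gridSet D B,
      (∀ i, |v i - L / (2 ^ (B - 1) * Real.sqrt D) * y i| ≤ L / (2 ^ B * Real.sqrt D)) ∧
        ‖v - (L / (2 ^ (B - 1) * Real.sqrt D)) • y‖ ≤ L / 2 ^ B := by
  have hDpos : (0 : ℝ) < D := by exact_mod_cast hD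
  have hs : 0 < Real.sqrt D := Real.sqrt_pos.2 hDpos
  obtain ⟨b, rfl⟩ : ∃ b, B = b + 1 := ⟨B - 1, by omega⟩
  simp only [Nat.add_sub_cancel]
  have hK : (0 : ℝ) < 2 ^ b := by positivity
  have hM : (2 : ℝ) ^ (b + 1) = 2 * 2 ^ b := by ring
  set t : ℝ := L / (2 ^ b * Real.sqrt D) with ht
  have htpos : 0 < t := by positivity
  have htK : L / Real.sqrt D = t * 2 ^ b := by rw [ht]; field_simp
  have hth : L / (2 ^ (b + 1) * Real.sqrt D) = t / 2 := by rw [ht, hM]; field_simp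
  have key : ∀ i, ∃ u : ℕ, u < 2 ^ (b + 1) ∧ (u : ℝ) ≤ v i / t + 2 ^ b ∧
      v i / t + 2 ^ b ≤ u + 1 := by
    intro i
    have h := abs_le.1 (hv i)
    rw [htK] at h
    have h1 : -(2 ^ b : ℝ) ≤ v i / t := by
      rw [le_div_iff₀ htpos]; linarith [h.1]
    have h2 : v i / t ≤ (2 ^ b : ℝ) := by
      rw [div_le_iff₀ htpos]; linarith [h.2]
    apply exists_cell _ Nat.one_le_two_pow _ (by linarith)
    push_cast
    rw [hM]; linarith
  choose u hu1 hu2 hu3 using key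
  have hco : ∀ i, |v i - t * (-((2 ^ (b + 1) : ℝ) - 1) / 2 + u i)| ≤ t / 2 := by
    intro i
    have e : v i = t * (v i / t) := by field_simp
    have e2 : v i - t * (-((2 ^ (b + 1) : ℝ) - 1) / 2 + u i)
        = t * (v i / t + 2 ^ b - 1 / 2 - u i) := by
      rw [hM]; linear_combination e
    rw [e2, abs_mul, abs_of_pos htpos]
    have : |v i / t + 2 ^ b - 1 / 2 - u i| ≤ 1 / 2 :=
      abs_le.2 ⟨by linarith [hu2 i], by linarith [hu3 i]⟩
    nlinarith
  refine ⟨WithLp.toLp 2 fun i => -((2 ^ (b + 1) : ℝ) - 1) / 2 + u i,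
    fun i => ⟨u i, hu1 i, rfl⟩, fun i => ?_, ?_⟩
  · rw [hth]; exact hco i
  · rw [EuclideanSpace.norm_eq]
    apply Real.sqrt_le_iff.2 ⟨by positivity, ?_⟩
    have hfin : L / 2 ^ (b + 1) = Real.sqrt D * (t / 2) := by
      rw [← hth]; field_simp
    rw [hfin, mul_pow, Real.sq_sqrt hDpos.le]
    calc _ ≤ ∑ i : Fin D, (t / 2) ^ 2 := by
          apply Finset.sum_le_sum
          intro i _
          rw [Real.norm_eq_abs]
          exact pow_le_pow_left₀ (abs_nonneg _) (hco i) 2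
      _ = _ := by simp
end
end

section
/- There exist absolute constants c₀ > 0 and c₁ > 0 such that the following holds for all integers D ≥ 1 and B ≥ 1, all reals L > 0, and all δ ∈ (0,1). Let o' be a random vector distributed according to the uniform (rotation-invariant) probability measure on the unit sphere S^{D−1} = {x ∈ ℝ^D : ‖x‖ = 1}, and let M(o') := max_{y ∈ 𝒢} ⟨o', y/‖y‖⟩. Then ℙ{ √(1 − M(o')²) > L/2^B + (c₁/√δ)·exp(−(c₀/2)·L²) } < δ. (Equivalently, writing ō for a quantized vector of o achieving the maximal cosine similarity with o over the randomly rotated codebook, √(1 − ⟨o, ō⟩²) ≤ L/2^B + (c₁/√δ)·exp(−(c₀/2)L²) with probability at least 1 − δ.) -/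
open MeasureTheory
open scoped RealInnerProductSpace

noncomputable section

/-- `M(x) = max_{y ∈ 𝒢} ⟨x, y/‖y‖⟩`, the maximal cosine similarity between `x` and the
normalized grid vectors. -/
def maxCosine (D B : ℕ) (x : EuclideanSpace ℝ (Fin D)) : ℝ :=
  sSup {r : ℝ | ∃ y ∈ gridSet D B, r = ⟪x, ‖y‖⁻¹ • y⟫}

theorem aux_round (t s : ℝ) (hs : 0 < s) (N : ℕ) (hN : 1 ≤ N) :
    ∃ u : ℕ, u < N ∧ |t - s * (-((N : ℝ) - 1) / 2 + u)| ≤ s / 2 + max (|t| - s * N / 2) 0 := by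
  obtain ⟨w, rfl⟩ : ∃ w, t = s * w := ⟨t / s, by field_simp⟩
  suffices h : ∃ u : ℕ, u < N ∧ |w - (-((N : ℝ) - 1) / 2 + u)| ≤ 1 / 2 + max (|w| - N / 2) 0 by
    obtain ⟨u, hu, h⟩ := h
    refine ⟨u, hu, ?_⟩
    have e1 : s * w - s * (-((N : ℝ) - 1) / 2 + u) = s * (w - (-((N : ℝ) - 1) / 2 + u)) := by ring
    have e2 : |s * w| - s * N / 2 = s * (|w| - N / 2) := by
      rw [abs_mul, abs_of_pos hs]; ring
    have e3 : max (s * (|w| - N / 2)) 0 = s * max (|w| - N / 2) 0 := by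
      rw [mul_max_of_nonneg _ _ hs.le, mul_zero]
    rw [e1, e2, e3, abs_mul, abs_of_pos hs]
    have := mul_le_mul_of_nonneg_left h hs.le
    linarith
  have hN' : (1 : ℝ) ≤ N := by exact_mod_cast hN
  have m1 := le_max_left (|w| - (N : ℝ) / 2) 0
  have m2 := le_max_right (|w| - (N : ℝ) / 2) 0
  have a1 := le_abs_self w
  have a2 := neg_abs_le w
  rcases lt_or_ge w (-(N : ℝ) / 2) with h1 | h1
  · refine ⟨0, by omega, ?_⟩
    rw [abs_le]; constructor <;> push_cast <;> linarith
  rcases le_or_gt ((N : ℝ) / 2) w with h2 | h2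
  · refine ⟨N - 1, by omega, ?_⟩
    rw [abs_le]; constructor <;> push_cast [Nat.cast_sub hN] <;> linarith
  · have h0 : 0 ≤ w + N / 2 := by linarith
    have f1 := Nat.floor_le h0
    have f2 := Nat.lt_floor_add_one (w + (N : ℝ) / 2)
    refine ⟨⌊w + (N : ℝ) / 2⌋₊, ?_, ?_⟩
    · rw [Nat.floor_lt h0]; linarith
    · rw [abs_le]; constructor <;> linarith

theorem aux_neg_mem (D B : ℕ) (y : EuclideanSpace ℝ (Fin D)) (hy : y ∈ gridSet D B) :
    -y ∈ gridSet D B := by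
  intro i
  obtain ⟨u, hu, h⟩ := hy i
  refine ⟨2 ^ B - 1 - u, by omega, ?_⟩
  have h3 : ((2 ^ B - 1 - u : ℕ) : ℝ) = 2 ^ B - 1 - u := by
    rw [Nat.cast_sub (by omega), Nat.cast_sub (by omega)]; push_cast; ring
  rw [h3, PiLp.neg_apply, h]; ring

theorem aux_max (D B : ℕ) (x y : EuclideanSpace ℝ (Fin D)) (hx : ‖x‖ = 1)
    (hy : y ∈ gridSet D B) (s : ℝ) :
    Real.sqrt (1 - maxCosine D B x ^ 2) ≤ ‖x - s • y‖ := by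
  have hb : BddAbove {r : ℝ | ∃ y ∈ gridSet D B, r = ⟪x, ‖y‖⁻¹ • y⟫} := by
    refine ⟨1, ?_⟩
    rintro r ⟨z, -, rfl⟩
    refine (real_inner_le_norm _ _).trans ?_
    rw [hx, norm_smul, norm_inv, norm_norm, one_mul]
    exact inv_mul_le_one
  have h1 : ⟪x, ‖y‖⁻¹ • y⟫ ≤ maxCosine D B x := le_csSup hb ⟨y, hy, rfl⟩
  have h2 : -⟪x, ‖y‖⁻¹ • y⟫ ≤ maxCosine D B x :=
    le_csSup hb ⟨-y, aux_neg_mem D B y hy, by simp [inner_smul_right]⟩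
  have h3 : ⟪x, y⟫ = ‖y‖ * ⟪x, ‖y‖⁻¹ • y⟫ := by
    rw [inner_smul_right]
    by_cases h : ‖y‖ = 0
    · have : y = 0 := by simpa using h
      simp [this]
    · field_simp
  set c := ⟪x, ‖y‖⁻¹ • y⟫
  have h4 : c ^ 2 ≤ maxCosine D B x ^ 2 := by
    rw [sq_le_sq]; exact (abs_le'.2 ⟨h1, h2⟩).trans (le_abs_self _)
  apply Real.sqrt_le_iff.2 ⟨norm_nonneg _, ?_⟩
  rw [norm_sub_sq_real, inner_smul_right, norm_smul, h3, hx, mul_pow, Real.norm_eq_abs, sq_abs]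
  nlinarith [sq_nonneg (s * ‖y‖ - c)]

theorem aux_det (D B : ℕ) (hD : 1 ≤ D) (L : ℝ) (hL : 0 < L)
    (x : EuclideanSpace ℝ (Fin D)) (hx : ‖x‖ = 1) :
    Real.sqrt (1 - maxCosine D B x ^ 2) ≤
      L / 2 ^ B + Real.sqrt (∑ i, (max (|x i| - L / Real.sqrt D) 0) ^ 2) := by
  have hD0 : (0 : ℝ) < D := by exact_mod_cast hD
  have hD1 : 0 < Real.sqrt D := Real.sqrt_pos.2 hD0
  have hN : (0 : ℝ) < 2 ^ B := by positivity
  set s : ℝ := 2 * L / (Real.sqrt D * 2 ^ B) with hs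
  have hs0 : 0 < s := by positivity
  have hsN : s * ((2 ^ B : ℕ) : ℝ) / 2 = L / Real.sqrt D := by
    rw [hs]; push_cast; field_simp
  have key := fun i => aux_round (x i) s hs0 (2 ^ B) Nat.one_le_two_pow
  choose u hu hk using key
  let y : EuclideanSpace ℝ (Fin D) := WithLp.toLp 2 fun i => -((2 ^ B : ℝ) - 1) / 2 + u i
  have hy : y ∈ gridSet D B := fun i => ⟨u i, hu i, rfl⟩
  refine (aux_max D B x y hx hy s).trans ?_
  let a : EuclideanSpace ℝ (Fin D) := WithLp.toLp 2 fun i => s / 2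
  let b : EuclideanSpace ℝ (Fin D) := WithLp.toLp 2 fun i => max (|x i| - L / Real.sqrt D) 0
  have h1 : ‖x - s • y‖ ≤ ‖a + b‖ := by
    rw [EuclideanSpace.norm_eq, EuclideanSpace.norm_eq]
    apply Real.sqrt_le_sqrt
    apply Finset.sum_le_sum
    intro i _
    apply pow_le_pow_left₀ (norm_nonneg _)
    have := hk i
    rw [hsN] at this
    push_cast at this
    refine le_trans ?_ (le_abs_self _)
    simpa [a, b, y] using this
  have ha : ‖a‖ = L / 2 ^ B := by
    rw [EuclideanSpace.norm_eq]
    simp only [a, Real.norm_eq_abs, sq_abs, Finset.sum_const, Finset.card_univ, Fintype.card_fin,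
      nsmul_eq_mul]
    rw [Real.sqrt_mul hD0.le, Real.sqrt_sq (by positivity), hs]
    field_simp
  have hb : ‖b‖ = Real.sqrt (∑ i, (max (|x i| - L / Real.sqrt D) 0) ^ 2) := by
    rw [EuclideanSpace.norm_eq]
    simp only [b, Real.norm_eq_abs, sq_abs]
  rw [← ha, ← hb]
  exact h1.trans (norm_add_le _ _)

theorem aux_sq_exp (g L l : ℝ) (hl : 1 ≤ l) :
    (max (|g| - L) 0) ^ 2 ≤ 2 * Real.exp (-l * L) * (Real.exp (l * g) + Real.exp (-(l * g))) := by
  have h0 : 2 * Real.exp (-l * L) * Real.exp (l * |g|) ≤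
      2 * Real.exp (-l * L) * (Real.exp (l * g) + Real.exp (-(l * g))) := by
    apply mul_le_mul_of_nonneg_left _ (by positivity)
    rcases abs_cases g with ⟨h, _⟩ | ⟨h, _⟩ <;> rw [h]
    · linarith [Real.exp_pos (-(l * g))]
    · rw [mul_neg]; linarith [Real.exp_pos (l * g)]
  refine le_trans ?_ h0
  rcases le_total (|g| - L) 0 with h | h
  · rw [max_eq_right h, zero_pow two_ne_zero]; positivity
  · rw [max_eq_left h, mul_assoc, ← Real.exp_add]
    have h1 := Real.quadratic_le_exp_of_nonneg h
    have h2 : Real.exp (|g| - L) ≤ Real.exp (-l * L + l * |g|) := by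
      apply Real.exp_le_exp.2; nlinarith
    nlinarith

theorem aux_int (D : ℕ) (μ : Measure (EuclideanSpace ℝ (Fin D))) [IsProbabilityMeasure μ]
    (h1 : ∀ᵐ x ∂μ, ‖x‖ = 1) (v : EuclideanSpace ℝ (Fin D)) :
    Integrable (fun x => Real.exp ⟪x, v⟫) μ := by
  refine Integrable.of_bound (Continuous.aestronglyMeasurable (by fun_prop)) (Real.exp ‖v‖) ?_
  filter_upwards [h1] with x hx
  rw [Real.norm_eq_abs, Real.abs_exp]
  apply Real.exp_le_exp.2
  simpa [hx] using real_inner_le_norm x v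

theorem aux_rot (D : ℕ) (μ : Measure (EuclideanSpace ℝ (Fin D)))
    (h2 : ∀ T : EuclideanSpace ℝ (Fin D) ≃ₗᵢ[ℝ] EuclideanSpace ℝ (Fin D), μ.map T = μ)
    (v w : EuclideanSpace ℝ (Fin D)) (hvw : ‖v‖ = ‖w‖) :
    ∫ x, Real.exp ⟪x, v⟫ ∂μ = ∫ x, Real.exp ⟪x, w⟫ ∂μ := by
  let T := ((ℝ ∙ (v - w))ᗮ).reflection
  have hT : T v = w := Submodule.reflection_sub hvw
  conv_rhs => rw [← h2 T]
  rw [integral_map T.continuous.aemeasurable (Continuous.aestronglyMeasurable (by fun_prop))]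
  congr 1; ext x
  rw [← hT, T.inner_map_map]

theorem aux_mgf (D : ℕ) (μ : Measure (EuclideanSpace ℝ (Fin D))) [IsProbabilityMeasure μ]
    (h1 : ∀ᵐ x ∂μ, ‖x‖ = 1)
    (h2 : ∀ T : EuclideanSpace ℝ (Fin D) ≃ₗᵢ[ℝ] EuclideanSpace ℝ (Fin D), μ.map T = μ)
    (l : ℝ) (v : EuclideanSpace ℝ (Fin D)) (hv : ‖v‖ = |l| * Real.sqrt D) :
    ∫ x, Real.exp ⟪x, v⟫ ∂μ ≤ Real.exp (l ^ 2 / 2) := by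
  let e : (Fin D → Bool) → EuclideanSpace ℝ (Fin D) :=
    fun b => WithLp.toLp 2 fun i => if b i then l else -l
  have he : ∀ b, ‖v‖ = ‖e b‖ := by
    intro b
    rw [hv, EuclideanSpace.norm_eq]
    have : ∀ i, ‖(e b) i‖ ^ 2 = l ^ 2 := by
      intro i
      simp only [e, Real.norm_eq_abs, sq_abs]
      split_ifs <;> ring
    simp only [this, Finset.sum_const, Finset.card_univ, Fintype.card_fin, nsmul_eq_mul]
    rw [mul_comm (D : ℝ), Real.sqrt_mul (sq_nonneg l), Real.sqrt_sq_eq_abs]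
  have hsum : ∑ b : Fin D → Bool, ∫ x, Real.exp ⟪x, e b⟫ ∂μ
      = 2 ^ D * ∫ x, Real.exp ⟪x, v⟫ ∂μ := by
    rw [Finset.sum_congr rfl fun b _ => (aux_rot D μ h2 v (e b) (he b)).symm]
    simp
  have hpt : ∀ x : EuclideanSpace ℝ (Fin D),
      ∑ b : Fin D → Bool, Real.exp ⟪x, e b⟫ = 2 ^ D * ∏ i, Real.cosh (l * x i) := by
    intro x
    have e1 : ∀ b, Real.exp ⟪x, e b⟫ = ∏ i, (fun (i : Fin D) (c : Bool) =>
        Real.exp ((if c then l else -l) * x i)) i (b i) := by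
      intro b
      rw [← Real.exp_sum, PiLp.inner_apply]
      simp [e]
    rw [Finset.sum_congr rfl fun b _ => e1 b, ← Fintype.prod_sum (fun (i : Fin D) (c : Bool) =>
        Real.exp ((if c then l else -l) * x i))]
    have : (2 : ℝ) ^ D = ∏ i : Fin D, 2 := by simp
    rw [this, ← Finset.prod_mul_distrib]
    apply Finset.prod_congr rfl
    intro i _
    rw [Real.cosh_eq]; simp; ring
  have hle : ∀ᵐ x ∂μ, ∑ b : Fin D → Bool, Real.exp ⟪x, e b⟫ ≤ 2 ^ D * Real.exp (l ^ 2 / 2) := by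
    filter_upwards [h1] with x hx
    rw [hpt]
    apply mul_le_mul_of_nonneg_left _ (by positivity)
    calc ∏ i, Real.cosh (l * x i) ≤ ∏ i, Real.exp ((l * x i) ^ 2 / 2) :=
          Finset.prod_le_prod (fun i _ => (Real.cosh_pos _).le)
            (fun i _ => Real.cosh_le_exp_half_sq _)
      _ = Real.exp (l ^ 2 / 2) := by
          rw [← Real.exp_sum]
          congr 1
          have := EuclideanSpace.norm_sq_eq x
          rw [hx] at this
          simp only [Real.norm_eq_abs, sq_abs] at this
          simp only [mul_pow, mul_div_right_comm]
          rw [← Finset.mul_sum, ← this]; ring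
  rw [← integral_finsetSum _ fun b _ => aux_int D μ h1 (e b)] at hsum
  have := integral_mono_ae (integrable_finsetSum _ fun b _ => aux_int D μ h1 (e b))
    (integrable_const _) hle
  rw [hsum] at this
  simp only [integral_const, probReal_univ, one_smul] at this
  exact le_of_mul_le_mul_left this (by positivity)

/-- there are absolute constants `c₀, c₁ > 0` such that for `o'` uniformly
distributed on the unit sphere, for all `L > 0` and `δ ∈ (0,1)`,
`ℙ{√(1 − M(o')²) > L/2^B + (c₁/√δ)·exp(−(c₀/2)·L²)} < δ`. -/
theorem quantization_error_tail_bound :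
    ∃ c₀ : ℝ, 0 < c₀ ∧ ∃ c₁ : ℝ, 0 < c₁ ∧
      ∀ (D B : ℕ), 1 ≤ D → 1 ≤ B → ∀ (L : ℝ), 0 < L → ∀ (δ : ℝ), δ ∈ Set.Ioo (0 : ℝ) 1 →
      ∀ (μ : Measure (EuclideanSpace ℝ (Fin D))),
        IsProbabilityMeasure μ →
        (∀ᵐ x ∂μ, ‖x‖ = 1) →
        (∀ T : EuclideanSpace ℝ (Fin D) ≃ₗᵢ[ℝ] EuclideanSpace ℝ (Fin D), μ.map T = μ) →
        μ {x : EuclideanSpace ℝ (Fin D) |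
            L / 2 ^ B + c₁ / Real.sqrt δ * Real.exp (-(c₀ / 2) * L ^ 2) <
              Real.sqrt (1 - maxCosine D B x ^ 2)} < ENNReal.ofReal δ := by
  refine ⟨1 / 2, by norm_num, 3, by norm_num, ?_⟩
  intro D B hD _ L hL δ hδ μ hμ h1 h2
  obtain ⟨hδ0, hδ1⟩ := hδ
  have hD0 : (0 : ℝ) < D := by exact_mod_cast hD
  have hD1 : 0 < Real.sqrt D := Real.sqrt_pos.2 hD0
  set l := L + 1 with hl
  let v : Fin D → EuclideanSpace ℝ (Fin D) :=
    fun i => EuclideanSpace.single i (l * Real.sqrt D)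
  have hv : ∀ i, ‖v i‖ = |l| * Real.sqrt D := fun i => by
    simp [v, abs_mul, abs_of_pos hD1]
  have hv' : ∀ i, ‖-v i‖ = |l| * Real.sqrt D := fun i => by rw [norm_neg, hv]
  have hvi : ∀ i x, ⟪x, v i⟫ = l * (Real.sqrt D * x i) := fun i x => by
    simp [v, EuclideanSpace.inner_single_right]; ring
  let S : EuclideanSpace ℝ (Fin D) → ℝ := fun x =>
    ∑ i, (2 * Real.exp (-l * L) / D) * (Real.exp ⟪x, v i⟫ + Real.exp ⟪x, -v i⟫)
  have hS0 : ∀ x, 0 ≤ S x := fun x => Finset.sum_nonneg fun i _ => by positivity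
  have hSi : ∀ i ∈ Finset.univ, Integrable (fun x =>
      (2 * Real.exp (-l * L) / D) * (Real.exp ⟪x, v i⟫ + Real.exp ⟪x, -v i⟫)) μ :=
    fun i _ => ((aux_int D μ h1 _).add (aux_int D μ h1 _)).const_mul _
  have hSint : Integrable S μ := integrable_finsetSum _ hSi
  have hSb : ∫ x, S x ∂μ ≤ 4 * Real.exp (1 / 2) * Real.exp (-L ^ 2 / 2) := by
    calc ∫ x, S x ∂μ = ∑ i, ∫ x, (2 * Real.exp (-l * L) / D) *
          (Real.exp ⟪x, v i⟫ + Real.exp ⟪x, -v i⟫) ∂μ := integral_finsetSum _ hSi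
      _ ≤ ∑ i : Fin D, (2 * Real.exp (-l * L) / D) *
          (Real.exp (l ^ 2 / 2) + Real.exp (l ^ 2 / 2)) := by
          apply Finset.sum_le_sum
          intro i _
          rw [integral_const_mul, integral_add (aux_int D μ h1 _) (aux_int D μ h1 _)]
          apply mul_le_mul_of_nonneg_left _ (by positivity)
          exact add_le_add (aux_mgf D μ h1 h2 l _ (hv i)) (aux_mgf D μ h1 h2 l _ (hv' i))
      _ = 4 * (Real.exp (-l * L) * Real.exp (l ^ 2 / 2)) := by
          simp only [Finset.sum_const, Finset.card_univ, Fintype.card_fin, nsmul_eq_mul]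
          field_simp; ring
      _ = 4 * Real.exp (1 / 2) * Real.exp (-L ^ 2 / 2) := by
          rw [mul_assoc, ← Real.exp_add, ← Real.exp_add]
          congr 2; rw [hl]; ring
      _ ≤ _ := le_rfl
  have hRS : ∀ x : EuclideanSpace ℝ (Fin D),
      ∑ i, (max (|x i| - L / Real.sqrt D) 0) ^ 2 ≤ S x := by
    intro x
    apply Finset.sum_le_sum
    intro i _
    have := aux_sq_exp (Real.sqrt D * x i) L l (by linarith)
    have e1 : max (|x i| - L / Real.sqrt D) 0 =
        (1 / Real.sqrt D) * max (|Real.sqrt D * x i| - L) 0 := by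
      rw [mul_max_of_nonneg _ _ (by positivity), mul_zero, abs_mul, abs_of_pos hD1]
      congr 1; field_simp
    rw [e1, mul_pow, inner_neg_right, hvi, div_pow, Real.sq_sqrt hD0.le, one_pow]
    calc _ ≤ 1 / (D : ℝ) * _ := mul_le_mul_of_nonneg_left this (by positivity)
      _ = _ := by ring
  set ε : ℝ := 9 / δ * Real.exp (-L ^ 2 / 2) with hε
  have hε0 : 0 < ε := by positivity
  have hsub : μ {x : EuclideanSpace ℝ (Fin D) |
      L / 2 ^ B + 3 / Real.sqrt δ * Real.exp (-(1 / 2 / 2) * L ^ 2) <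
        Real.sqrt (1 - maxCosine D B x ^ 2)} ≤ μ {x | ε ≤ S x} := by
    apply measure_mono_ae
    filter_upwards [h1] with x hx hlt
    change ε ≤ S x
    have hlt' : L / 2 ^ B + 3 / Real.sqrt δ * Real.exp (-(1 / 2 / 2) * L ^ 2) <
        Real.sqrt (1 - maxCosine D B x ^ 2) := hlt
    have h3 := aux_det D B hD L hL x hx
    have h4 : 3 / Real.sqrt δ * Real.exp (-(1 / 2 / 2) * L ^ 2) ≤ Real.sqrt (S x) := by
      have := Real.sqrt_le_sqrt (hRS x)
      linarith
    rw [Real.le_sqrt (by positivity) (hS0 x), mul_pow, div_pow, Real.sq_sqrt hδ0.le,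
      ← Real.exp_nat_mul] at h4
    convert h4 using 1
    rw [hε]; push_cast
    congr 2 <;> ring
  refine lt_of_le_of_lt hsub ?_
  have hM := mul_meas_ge_le_integral_of_nonneg (Filter.Eventually.of_forall hS0) hSint ε
  have he : Real.exp (1 / 2) < 2 := by
    have h := Real.exp_one_lt_d9
    have h' : Real.exp (1 / 2) * Real.exp (1 / 2) = Real.exp 1 := by
      rw [← Real.exp_add]; norm_num
    nlinarith [Real.exp_pos (1 / 2)]
  have hεδ : ε * δ = 9 * Real.exp (-L ^ 2 / 2) := by rw [hε]; field_simp
  have hlt : ε * μ.real {x | ε ≤ S x} < ε * δ := by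
    rw [hεδ]
    nlinarith [Real.exp_pos (-L ^ 2 / 2)]
  have := lt_of_mul_lt_mul_left hlt hε0.le
  rw [← ENNReal.ofReal_toReal (measure_ne_top μ {x | ε ≤ S x})]
  exact (ENNReal.ofReal_lt_ofReal_iff hδ0).2 this
end
end

section
/- There exist absolute constants c₀ > 0 and c₁ > 0 such that the following holds. Let D ≥ 2 and B ≥ 1 be integers, let o, q ∈ ℝ^D be fixed unit vectors, δ ∈ (0,1), and L > 0. Let P be a random D×D orthogonal matrix distributed according to the Haar probability measure on O(D), let ȳ ∈ 𝒢 be a cosine maximizer of Pᵀo over 𝒢 (for Haar-almost-every P the maximizing unit direction ȳ/‖ȳ‖ is unique and satisfies ⟨Pᵀo, ȳ⟩ > 0, so the following is almost surely well-defined), and set ō := P·ȳ/‖ȳ‖. Then with probability at least 1 − 2δ over P, | ⟨ō, q⟩/⟨ō, o⟩ − ⟨o, q⟩ | ≤ [ L/2^B + (c₁/√δ)·exp(−(c₀/2)·L²) ] · √( log(1/δ) / (c₀ (D−1)) ). -/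
open MeasureTheory Matrix
open scoped RealInnerProductSpace

noncomputable section

/-- The extended RaBitQ quantized vector `ō = P·ȳ/‖ȳ‖` built from a grid vector `ȳ`. -/
def quantized (D : ℕ) (P : Matrix (Fin D) (Fin D) ℝ) (ybar : EuclideanSpace ℝ (Fin D)) :
    EuclideanSpace ℝ (Fin D) :=
  Matrix.toEuclideanLin P (‖ybar‖⁻¹ • ybar)

instance rabBorel (D : ℕ) : BorelSpace (Matrix (Fin D) (Fin D) ℝ) := ⟨rfl⟩

/-- action of an orthogonal matrix -/
def ra {D : ℕ} (P : Matrix.orthogonalGroup (Fin D) ℝ) :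
    EuclideanSpace ℝ (Fin D) →ₗ[ℝ] EuclideanSpace ℝ (Fin D) :=
  Matrix.toEuclideanLin (P : Matrix (Fin D) (Fin D) ℝ)

lemma ra_mul {D : ℕ} (Q P : Matrix.orthogonalGroup (Fin D) ℝ) (x : EuclideanSpace ℝ (Fin D)) :
    ra (Q * P) x = ra Q (ra P x) := by
  simp [ra]

lemma ra_inner_T {D : ℕ} (P : Matrix.orthogonalGroup (Fin D) ℝ)
    (x y : EuclideanSpace ℝ (Fin D)) :
    ⟪ra P x, y⟫ = ⟪x, Matrix.toEuclideanLin (P : Matrix (Fin D) (Fin D) ℝ)ᵀ y⟫ := by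
  have h := Matrix.toEuclideanLin_conjTranspose_eq_adjoint (P : Matrix (Fin D) (Fin D) ℝ)
  rw [Matrix.conjTranspose_eq_transpose_of_trivial] at h
  rw [h, LinearMap.adjoint_inner_right, ra]

lemma ra_inner {D : ℕ} (P : Matrix.orthogonalGroup (Fin D) ℝ)
    (x y : EuclideanSpace ℝ (Fin D)) : ⟪ra P x, ra P y⟫ = ⟪x, y⟫ := by
  rw [ra_inner_T]
  congr 1
  have h : (P : Matrix (Fin D) (Fin D) ℝ)ᵀ * (P : Matrix (Fin D) (Fin D) ℝ) = 1 := by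
    have := (Matrix.mem_orthogonalGroup_iff' (Fin D) ℝ).1 P.2
    simpa using this
  unfold ra
  rw [← LinearMap.comp_apply, ← Matrix.toLpLin_mul_same, h]
  simp

lemma ra_norm {D : ℕ} (P : Matrix.orthogonalGroup (Fin D) ℝ)
    (x : EuclideanSpace ℝ (Fin D)) : ‖ra P x‖ = ‖x‖ := by
  rw [norm_eq_sqrt_real_inner, norm_eq_sqrt_real_inner, ra_inner]

lemma exists_refl {D : ℕ} (a b : EuclideanSpace ℝ (Fin D)) (h : ‖a‖ = ‖b‖) :
    ∃ Q : Matrix.orthogonalGroup (Fin D) ℝ, ra Q a = b ∧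
      ∀ o, ⟪o, a⟫ = ⟪o, b⟫ → ra Q o = o := by
  let R := (Submodule.span ℝ {a - b})ᗮ.reflection
  let e := EuclideanSpace.basisFun (Fin D) ℝ
  let M := Matrix.toEuclideanLin.symm (R.toLinearEquiv.toLinearMap)
  have hM : Matrix.toEuclideanLin M = R.toLinearEquiv.toLinearMap := by simp [M]
  have hMa : ∀ x, Matrix.toEuclideanLin M x = R x := by intro x; rw [hM]; rfl
  have hmem : M ∈ Matrix.orthogonalGroup (Fin D) ℝ := by
    rw [Matrix.mem_orthogonalGroup_iff']
    apply Matrix.toEuclideanLin.injective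
    rw [Matrix.toLpLin_mul_same, ← Matrix.conjTranspose_eq_transpose_of_trivial,
      Matrix.toEuclideanLin_conjTranspose_eq_adjoint]
    ext1 x
    refine ext_inner_right ℝ fun y => ?_
    rw [LinearMap.comp_apply, LinearMap.adjoint_inner_left, hMa, hMa, R.inner_map_map]
    simp
  refine ⟨⟨M, hmem⟩, ?_, ?_⟩
  · change Matrix.toEuclideanLin M a = b
    rw [hMa]; exact Submodule.reflection_sub h
  · intro o ho
    change Matrix.toEuclideanLin M o = o
    rw [hMa]
    apply Submodule.reflection_mem_subspace_eq_self
    rw [Submodule.mem_orthogonal_singleton_iff_inner_left, inner_sub_right, ho, sub_self]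

lemma ra_continuous {D : ℕ} (x : EuclideanSpace ℝ (Fin D)) :
    Continuous (fun P : Matrix.orthogonalGroup (Fin D) ℝ => ra P x) := by
  unfold ra
  simp only [Matrix.toLpLin_apply]
  apply (PiLp.continuous_toLp 2 _).comp
  exact Continuous.matrix_mulVec continuous_subtype_val continuous_const

/-- signs -/
def sg (b : Bool) : ℝ := if b then 1 else -1

lemma rademacher {D n : ℕ} (b : Fin n → EuclideanSpace ℝ (Fin D)) (hb : Orthonormal ℝ b)
    (X : EuclideanSpace ℝ (Fin D)) (hX : ‖X‖ ≤ 1) (a : ℝ) :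
    ∑ ε : Fin n → Bool, Real.exp (a * ⟪X, ∑ i, sg (ε i) • b i⟫) ≤
      2 ^ n * Real.exp (a ^ 2 / 2) := by
  have h1 : ∀ ε : Fin n → Bool, Real.exp (a * ⟪X, ∑ i, sg (ε i) • b i⟫) =
      ∏ i, Real.exp (a * ⟪X, b i⟫ * sg (ε i)) := by
    intro ε
    rw [← Real.exp_sum, inner_sum, Finset.mul_sum]
    congr 1
    apply Finset.sum_congr rfl
    intro i _
    rw [inner_smul_right]; ring
  simp_rw [h1]
  have h2 := Finset.prod_univ_sum (fun _ : Fin n => (Finset.univ : Finset Bool))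
    (fun i j => Real.exp (a * ⟪X, b i⟫ * sg j))
  rw [Fintype.piFinset_univ] at h2
  rw [← h2]
  have h3 : ∀ i, ∑ j : Bool, Real.exp (a * ⟪X, b i⟫ * sg j) ≤
      2 * Real.exp ((a * ⟪X, b i⟫) ^ 2 / 2) := by
    intro i
    have := Real.cosh_le_exp_half_sq (a * ⟪X, b i⟫)
    rw [Real.cosh_eq] at this
    simp [sg]
    linarith
  calc _ ≤ ∏ i, (2 * Real.exp ((a * ⟪X, b i⟫) ^ 2 / 2)) :=
        Finset.prod_le_prod (fun i _ => Finset.sum_nonneg fun j _ => (Real.exp_pos _).le)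
          (fun i _ => h3 i)
    _ = 2 ^ n * Real.exp (a ^ 2 / 2 * ∑ i, ⟪X, b i⟫ ^ 2) := by
        rw [Finset.prod_mul_distrib, ← Real.exp_sum, Finset.mul_sum]
        simp
        congr 1
        ext i; ring
    _ ≤ _ := by
        have h4 : ∑ i, ⟪X, b i⟫ ^ 2 ≤ 1 := by
          have := hb.sum_inner_products_le X (s := Finset.univ)
          calc _ = ∑ i, ‖⟪b i, X⟫‖ ^ 2 := by
                apply Finset.sum_congr rfl; intro i _
                rw [real_inner_comm, Real.norm_eq_abs, sq_abs]
            _ ≤ ‖X‖ ^ 2 := this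
            _ ≤ 1 := by nlinarith [norm_nonneg X]
        gcongr
        nlinarith [sq_nonneg a]

lemma sg_norm {D n : ℕ} (b : Fin n → EuclideanSpace ℝ (Fin D)) (hb : Orthonormal ℝ b)
    (ε : Fin n → Bool) : ‖∑ i, sg (ε i) • b i‖ = Real.sqrt n := by
  rw [norm_eq_sqrt_real_inner, hb.inner_sum]
  congr 1
  have : ∀ i, sg (ε i) * sg (ε i) = 1 := by intro i; unfold sg; split <;> norm_num
  simp [this]

/-- abstract subgaussian bound -/
lemma mgf_bound {Ω : Type*} [MeasurableSpace Ω] (ν : Measure Ω) {D n : ℕ} (hn : 0 < n)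
    (b : Fin n → EuclideanSpace ℝ (Fin D)) (hb : Orthonormal ℝ b)
    (X : Ω → EuclideanSpace ℝ (Fin D)) (hXm : Measurable X) (hX : ∀ ω, ‖X ω‖ ≤ 1)
    (q : EuclideanSpace ℝ (Fin D)) (r s : ℝ) (hr0 : 0 ≤ r) (hr : r ≤ 1)
    (h : ∀ ε : Fin n → Bool, ∫⁻ ω, ENNReal.ofReal (Real.exp (s * ⟪X ω, q⟫)) ∂ν =
      ∫⁻ ω, ENNReal.ofReal (Real.exp (s *
        ⟪X ω, (r / Real.sqrt n) • ∑ i, sg (ε i) • b i⟫)) ∂ν) :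
    ∫⁻ ω, ENNReal.ofReal (Real.exp (s * ⟪X ω, q⟫)) ∂ν ≤
      ENNReal.ofReal (Real.exp (s ^ 2 / (2 * n))) * ν Set.univ := by
  set I := ∫⁻ ω, ENNReal.ofReal (Real.exp (s * ⟪X ω, q⟫)) ∂ν
  have h1 : (2 ^ n : ENNReal) * I ≤
      2 ^ n * (ENNReal.ofReal (Real.exp (s ^ 2 / (2 * n))) * ν Set.univ) := by
    calc (2 ^ n : ENNReal) * I = ∑ ε : Fin n → Bool, I := by simp
      _ = ∑ ε : Fin n → Bool, ∫⁻ ω, ENNReal.ofReal (Real.exp (s *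
        ⟪X ω, (r / Real.sqrt n) • ∑ i, sg (ε i) • b i⟫)) ∂ν :=
          Finset.sum_congr rfl fun ε _ => h ε
      _ = ∫⁻ ω, ∑ ε : Fin n → Bool, ENNReal.ofReal (Real.exp (s *
        ⟪X ω, (r / Real.sqrt n) • ∑ i, sg (ε i) • b i⟫)) ∂ν := by
          rw [lintegral_finsetSum]
          intro ε _
          fun_prop
      _ ≤ ∫⁻ ω, ENNReal.ofReal (2 ^ n * Real.exp (s ^ 2 / (2 * n))) ∂ν := by
          apply lintegral_mono
          intro ω
          simp only
          rw [← ENNReal.ofReal_sum_of_nonneg (fun _ _ => (Real.exp_pos _).le)]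
          apply ENNReal.ofReal_le_ofReal
          have := rademacher b hb (X ω) (hX ω) (s * (r / Real.sqrt n))
          simp_rw [inner_smul_right, ← mul_assoc]
          refine this.trans ?_
          refine mul_le_mul_of_nonneg_left (Real.exp_le_exp.2 ?_) (by positivity)
          have hn' : (0 : ℝ) < n := by exact_mod_cast hn
          rw [mul_pow, div_pow, Real.sq_sqrt hn'.le]
          have : r ^ 2 ≤ 1 := by nlinarith
          rw [div_le_div_iff₀ (by positivity) (by positivity)]
          have : s ^ 2 * (r ^ 2 / n) * (2 * n) = 2 * (s ^ 2 * r ^ 2) := by field_simp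
          rw [this]
          nlinarith [sq_nonneg s]
      _ = _ := by
          rw [lintegral_const, ENNReal.ofReal_mul (by positivity), mul_assoc]
          congr 1
          rw [ENNReal.ofReal_pow (by norm_num)]; simp
  exact (ENNReal.mul_le_mul_iff_right (by positivity) (by simp)).1 h1
lemma round_scalar (B : ℕ) (hB : 1 ≤ B) (x : ℝ) :
    ∃ u : ℕ, u < 2 ^ B ∧ ∃ y : ℝ, y = -((2 ^ B : ℝ) - 1) / 2 + u ∧
      (y - x) ^ 2 ≤ 1 / 4 + (if (2 : ℝ) ^ B / 2 < |x| then x ^ 2 else 0) ∧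
      x ^ 2 / 2 - (if (2 : ℝ) ^ B / 2 < |x| then x ^ 2 else 0) / 2 ≤ y * x ∧
      y ^ 2 ≤ 2 * x ^ 2 + 1 / 2 := by
  obtain ⟨k, rfl⟩ : ∃ k, B = k + 1 := ⟨B - 1, by omega⟩
  obtain ⟨N, hN⟩ : ∃ N : ℕ, N = 2 ^ k := ⟨_, rfl⟩
  have hN1 : 1 ≤ N := by rw [hN]; exact Nat.one_le_two_pow
  have hN1' : (1 : ℝ) ≤ N := by exact_mod_cast hN1
  have e1 : 2 ^ (k + 1) = 2 * N := by rw [hN]; ring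
  have e2 : (2 : ℝ) ^ (k + 1) = 2 * N := by rw [hN]; push_cast; ring
  rw [e1, e2]
  have e3 : (2 * N : ℝ) / 2 = N := by ring
  rw [e3]
  by_cases h1 : (N : ℝ) ≤ x
  · refine ⟨2 * N - 1, by omega, N - 1 / 2, ?_, ?_, ?_, ?_⟩
    · rw [Nat.cast_sub (by omega)]; push_cast; ring
    · split_ifs with h
      · nlinarith
      · rw [abs_of_nonneg (by linarith)] at h
        have : x = N := by linarith
        rw [this]; nlinarith
    · split_ifs with h
      · nlinarith
      · rw [abs_of_nonneg (by linarith)] at h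
        have : x = N := by linarith
        rw [this]; nlinarith
    · nlinarith
  by_cases h2 : x < -N
  · have h : (N : ℝ) < |x| := by rw [abs_of_neg (by linarith)]; linarith
    rw [if_pos h]
    refine ⟨0, by omega, -N + 1 / 2, ?_, ?_, ?_, ?_⟩
    · push_cast; ring
    · nlinarith
    · nlinarith
    · nlinarith
  push Not at h1 h2
  have h : ¬ (N : ℝ) < |x| := by
    rw [not_lt, abs_le]; constructor <;> linarith
  rw [if_neg h]
  have f1 := Int.floor_le x
  have f2 := Int.lt_floor_add_one x
  have f3 : -(N : ℤ) ≤ ⌊x⌋ := by rw [Int.le_floor]; push_cast; exact h2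
  have f4 : ⌊x⌋ < (N : ℤ) := by rw [Int.floor_lt]; push_cast; exact h1
  obtain ⟨u, hu⟩ := Int.eq_ofNat_of_zero_le (show 0 ≤ ⌊x⌋ + N by omega)
  have hu' : (⌊x⌋ : ℝ) + N = u := by exact_mod_cast hu
  have e5 : ((⌊x⌋ : ℝ) + 1 / 2 - x) ^ 2 ≤ 1 / 4 := by nlinarith
  refine ⟨u, by omega, ⌊x⌋ + 1 / 2, ?_, ?_, ?_, ?_⟩
  · rw [← hu']; ring
  · linarith
  · have key : x ^ 2 / 2 ≤ ((⌊x⌋ : ℝ) + 1 / 2) * x := by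
      rcases le_or_gt 0 x with hx | hx
      · have : (0 : ℤ) ≤ ⌊x⌋ := Int.floor_nonneg.2 hx
        have : (0 : ℝ) ≤ ⌊x⌋ := by exact_mod_cast this
        have : x / 2 ≤ (⌊x⌋ : ℝ) + 1 / 2 := by linarith
        nlinarith
      · have : ⌊x⌋ < (0 : ℤ) := by rw [Int.floor_lt]; simpa using hx
        have : ⌊x⌋ ≤ (-1 : ℤ) := by omega
        have : (⌊x⌋ : ℝ) ≤ -1 := by exact_mod_cast this
        have : (⌊x⌋ : ℝ) + 1 / 2 ≤ x / 2 := by linarith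
        nlinarith
    linarith
  · nlinarith [sq_nonneg ((⌊x⌋ : ℝ) + 1 / 2 - 2 * x)]

/-- tail mass -/
def tail {D : ℕ} (M : ℝ) (u : EuclideanSpace ℝ (Fin D)) : ℝ :=
  ∑ i, if M < Real.sqrt D * |u i| then (u i) ^ 2 else 0

lemma tail_nonneg {D : ℕ} (M : ℝ) (u : EuclideanSpace ℝ (Fin D)) : 0 ≤ tail M u :=
  Finset.sum_nonneg fun i _ => by split_ifs <;> positivity

lemma grid_ne_zero {D B : ℕ} (hD : 0 < D) (hB : 1 ≤ B) (y : EuclideanSpace ℝ (Fin D))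
    (hy : y ∈ gridSet D B) : y ≠ 0 := by
  rintro rfl
  obtain ⟨u, hu, h⟩ := hy ⟨0, hD⟩
  obtain ⟨k, rfl⟩ : ∃ k, B = k + 1 := ⟨B - 1, by omega⟩
  simp only [PiLp.zero_apply] at h
  have : ((2 ^ (k + 1) : ℕ) : ℝ) = ((2 * u + 1 : ℕ) : ℝ) := by push_cast; linarith
  have := Nat.cast_injective this
  rw [pow_succ] at this
  omega

lemma scalar_tan (t s c' c m τ : ℝ) (hs0 : 0 < s) (hYn : 0 < t) (hm0 : 0 < m) (hτ0 : 0 ≤ τ)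
    (hτ : τ ≤ 1 / 2) (hcc : c' ≤ c)
    (S2 : s ^ 2 / 2 - s ^ 2 * τ / 2 ≤ s * (t * c'))
    (S3 : t ^ 2 ≤ 2 * s ^ 2 * (1 + m ^ 2))
    (S1' : t ^ 2 - 2 * s * (t * c') + s ^ 2 ≤ s ^ 2 * (m ^ 2 + τ)) :
    0 < c ∧ Real.sqrt (1 - c ^ 2) ≤ 8 * (m + Real.sqrt τ) * c := by
  have S2' : s / 4 ≤ t * c' := by
    have : s * (s / 4) ≤ s * (t * c') := by nlinarith [sq_nonneg s]
    exact le_of_mul_le_mul_left this hs0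
  have hc'0 : 0 < c' := by
    by_contra hneg; push Not at hneg
    nlinarith
  have hc0 : 0 < c := lt_of_lt_of_le hc'0 hcc
  refine ⟨hc0, ?_⟩
  have hsin : 1 - c ^ 2 ≤ m ^ 2 + τ := by
    have h5 : s ^ 2 * (1 - c' ^ 2) ≤ s ^ 2 * (m ^ 2 + τ) := by
      nlinarith only [sq_nonneg (t - s * c'), S1']
    have h6 := le_of_mul_le_mul_left h5 (by positivity)
    nlinarith only [h6, hcc, hc'0, hc0]
  have hcos : 1 ≤ 32 * (1 + m ^ 2) * c ^ 2 := by
    have h7 : s ^ 2 / 16 ≤ t ^ 2 * c' ^ 2 := by nlinarith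
    have h8 : t ^ 2 * c' ^ 2 ≤ 2 * s ^ 2 * (1 + m ^ 2) * c ^ 2 := by
      have : c' ^ 2 ≤ c ^ 2 := by nlinarith
      exact mul_le_mul S3 this (by positivity) (by positivity)
    have h9 : s ^ 2 * 1 ≤ s ^ 2 * (32 * (1 + m ^ 2) * c ^ 2) := by nlinarith
    exact le_of_mul_le_mul_left h9 (by positivity)
  have hsτ := Real.sqrt_nonneg τ
  have hsτ2 := Real.sq_sqrt hτ0
  apply Real.sqrt_le_iff.2
  refine ⟨by positivity, ?_⟩
  have hsq : m ^ 2 + τ ≤ (m + Real.sqrt τ) ^ 2 := by nlinarith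
  rcases le_total m 1 with hm1 | hm1
  · have h10 : 1 ≤ 64 * c ^ 2 := by nlinarith [sq_nonneg c, mul_nonneg (sq_nonneg c) (by nlinarith : 0 ≤ 1 - m ^ 2)]
    calc 1 - c ^ 2 ≤ (m + Real.sqrt τ) ^ 2 * 1 := by linarith
      _ ≤ (m + Real.sqrt τ) ^ 2 * (64 * c ^ 2) := by gcongr
      _ = _ := by ring
  · have h10 : 1 ≤ 64 * m ^ 2 * c ^ 2 := by nlinarith [mul_nonneg (sq_nonneg c) (by nlinarith : 0 ≤ m ^ 2 - 1)]
    calc 1 - c ^ 2 ≤ 1 := by nlinarith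
      _ ≤ 64 * m ^ 2 * c ^ 2 := h10
      _ ≤ 64 * (m + Real.sqrt τ) ^ 2 * c ^ 2 := by gcongr; linarith
      _ = _ := by ring

lemma tan_bound {D B : ℕ} (hD : 0 < D) (hB : 1 ≤ B) (u v : EuclideanSpace ℝ (Fin D))
    (hu : ‖u‖ = 1) (M : ℝ) (hM : 0 < M) (hτ : tail M u ≤ 1 / 2)
    (hv : ∀ y ∈ gridSet D B, ⟪‖y‖⁻¹ • y, u⟫ ≤ ⟪v, u⟫) :
    0 < ⟪v, u⟫ ∧ Real.sqrt (1 - ⟪v, u⟫ ^ 2) ≤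
      8 * (M / 2 ^ B + Real.sqrt (tail M u)) * ⟪v, u⟫ := by
  have hD' : (0 : ℝ) < D := by exact_mod_cast hD
  set τ := tail M u with hτd
  have hτ0 : 0 ≤ τ := tail_nonneg M u
  set s := Real.sqrt D * 2 ^ B / (2 * M) with hs
  have hs0 : 0 < s := by positivity
  choose k hk y hy h1 h2 h3 using fun i => round_scalar B hB (s * u i)
  let Y : EuclideanSpace ℝ (Fin D) := WithLp.toLp 2 y
  have hY : ∀ i, Y i = y i := fun i => rfl
  have hYg : Y ∈ gridSet D B := fun i => ⟨k i, hk i, hy i⟩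
  have hY0 : Y ≠ 0 := grid_ne_zero hD hB Y hYg
  have hYn : 0 < ‖Y‖ := norm_pos_iff.2 hY0
  have hu2 : ∑ i, u i ^ 2 = 1 := by
    have := EuclideanSpace.real_norm_sq_eq u
    rw [hu] at this; linarith
  have hYY : ‖Y‖ ^ 2 = ∑ i, y i ^ 2 := EuclideanSpace.real_norm_sq_eq Y
  have hYu : ⟪Y, u⟫ = ∑ i, y i * u i := by
    rw [PiLp.inner_apply]
    apply Finset.sum_congr rfl
    intro i _
    simp [hY, mul_comm]
  set m := M / 2 ^ B with hm
  have hm0 : 0 < m := by positivity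
  have hsm : s ^ 2 * m ^ 2 = D / 4 := by
    rw [hs, hm, div_pow, mul_pow, Real.sq_sqrt hD'.le]; field_simp; norm_num
  have hcond : ∀ i, ((2 : ℝ) ^ B / 2 < |s * u i|) ↔ (M < Real.sqrt D * |u i|) := by
    intro i
    rw [abs_mul, abs_of_pos hs0, hs, ← sub_pos, ← sub_pos (a := Real.sqrt D * _)]
    have : Real.sqrt D * 2 ^ B / (2 * M) * |u i| - 2 ^ B / 2 =
      (2 ^ B / (2 * M)) * (Real.sqrt D * |u i| - M) := by field_simp
    rw [this]
    exact mul_pos_iff_of_pos_left (by positivity)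
  have hsum : ∑ i, (if (2 : ℝ) ^ B / 2 < |s * u i| then (s * u i) ^ 2 else 0) = s ^ 2 * τ := by
    rw [hτd, tail, Finset.mul_sum]
    apply Finset.sum_congr rfl
    intro i _
    by_cases h : M < Real.sqrt D * |u i|
    · rw [if_pos h, if_pos ((hcond i).2 h)]; ring
    · rw [if_neg h, if_neg (fun h' => h ((hcond i).1 h'))]; ring
  have hsu : ∑ i, (s * u i) ^ 2 = s ^ 2 := by
    simp_rw [mul_pow]; rw [← Finset.mul_sum, hu2, mul_one]
  -- three sums
  have S1 : ∑ i, (y i - s * u i) ^ 2 ≤ D / 4 + s ^ 2 * τ := by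
    refine (Finset.sum_le_sum fun i _ => h1 i).trans ?_
    rw [Finset.sum_add_distrib, hsum]
    simp; linarith
  have S2 : s ^ 2 / 2 - s ^ 2 * τ / 2 ≤ s * ⟪Y, u⟫ := by
    have := Finset.sum_le_sum fun i (_ : i ∈ Finset.univ) => h2 i
    rw [Finset.sum_sub_distrib, ← Finset.sum_div, ← Finset.sum_div, hsum, hsu] at this
    refine this.trans (le_of_eq ?_)
    rw [hYu, Finset.mul_sum]
    apply Finset.sum_congr rfl; intro i _; ring
  have S3 : ‖Y‖ ^ 2 ≤ 2 * s ^ 2 * (1 + m ^ 2) := by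
    rw [hYY]
    refine (Finset.sum_le_sum fun i _ => h3 i).trans ?_
    rw [Finset.sum_add_distrib, ← Finset.mul_sum, hsu]
    simp; linarith
  have S1' : ‖Y‖ ^ 2 - 2 * s * ⟪Y, u⟫ + s ^ 2 ≤ s ^ 2 * (m ^ 2 + τ) := by
    have : ∑ i, (y i - s * u i) ^ 2 = ‖Y‖ ^ 2 - 2 * s * ⟪Y, u⟫ + s ^ 2 := by
      rw [hYY, hYu, Finset.mul_sum, ← Finset.sum_sub_distrib, ← hsu, ← Finset.sum_add_distrib]
      apply Finset.sum_congr rfl; intro i _; ring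
    rw [← this]; linarith
  -- cosine
  set c := ⟪v, u⟫ with hc
  set c' := ⟪‖Y‖⁻¹ • Y, u⟫ with hc'
  have hcc : c' ≤ c := hv Y hYg
  have hYc : ⟪Y, u⟫ = ‖Y‖ * c' := by
    rw [hc', inner_smul_left]; simp; field_simp
  rw [hYc] at S2 S1'
  exact scalar_tan ‖Y‖ s c' c m τ hs0 hYn hm0 hτ0 hτ hcc S2 S3 S1'

lemma mgf_inv {D n : ℕ} (hn : 0 < n) (μ : Measure (Matrix.orthogonalGroup (Fin D) ℝ))
    [μ.IsMulLeftInvariant]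
    (A : Set (Matrix.orthogonalGroup (Fin D) ℝ)) (hA : MeasurableSet A)
    (X : Matrix.orthogonalGroup (Fin D) ℝ → EuclideanSpace ℝ (Fin D)) (hXm : Measurable X)
    (hX : ∀ P, ‖X P‖ ≤ 1) (p : Matrix.orthogonalGroup (Fin D) ℝ → Prop)
    (hpA : ∀ Q, p Q → ∀ P, Q * P ∈ A ↔ P ∈ A)
    (hpX : ∀ Q, p Q → ∀ P, X (Q * P) = ra Q (X P))
    (q q' : EuclideanSpace ℝ (Fin D)) (hqq : ∀ P, ⟪X P, q⟫ = ⟪X P, q'⟫)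
    (r : ℝ) (hr0 : 0 ≤ r) (hr : r ≤ 1)
    (b : Fin n → EuclideanSpace ℝ (Fin D)) (hb : Orthonormal ℝ b)
    (hQ : ∀ ε : Fin n → Bool, ∃ Q, p Q ∧ ra Q q' = (r / Real.sqrt n) • ∑ i, sg (ε i) • b i)
    (s : ℝ) :
    ∫⁻ P in A, ENNReal.ofReal (Real.exp (s * ⟪X P, q⟫)) ∂μ ≤
      ENNReal.ofReal (Real.exp (s ^ 2 / (2 * n))) * μ A := by
  have := mgf_bound (μ.restrict A) hn b hb X hXm hX q r s hr0 hr ?_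
  · simpa using this
  intro ε
  obtain ⟨Q, hpQ, hQw⟩ := hQ ε
  rw [← lintegral_indicator hA, ← lintegral_indicator hA]
  rw [← lintegral_mul_left_eq_self (μ := μ) (A.indicator fun ω => ENNReal.ofReal (Real.exp (s *
        ⟪X ω, (r / Real.sqrt n) • ∑ i, sg (ε i) • b i⟫))) Q]
  congr 1
  ext P
  by_cases h : P ∈ A
  · rw [Set.indicator_of_mem h, Set.indicator_of_mem ((hpA Q hpQ P).2 h), hpX Q hpQ P, ← hQw,
      ra_inner, hqq]
  · rw [Set.indicator_of_notMem h, Set.indicator_of_notMem (fun h' => h ((hpA Q hpQ P).1 h'))]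

lemma tail_inv {D : ℕ} (ν : Measure (Matrix.orthogonalGroup (Fin D) ℝ))
    (n : ℕ) (hn : 0 < n) (m : ENNReal) (Z : Matrix.orthogonalGroup (Fin D) ℝ → ℝ)
    (hZ : Measurable Z)
    (h : ∀ s : ℝ, ∫⁻ P, ENNReal.ofReal (Real.exp (s * Z P)) ∂ν ≤
      ENNReal.ofReal (Real.exp (s ^ 2 / (2 * n))) * m) (t : ℝ) (ht : 0 ≤ t) :
    ν {P | t < |Z P|} ≤ ENNReal.ofReal (2 * Real.exp (-(n * t ^ 2 / 2))) * m := by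
  have hn' : (0 : ℝ) < n := by exact_mod_cast hn
  have one : ∀ σ : ℝ, σ ^ 2 = 1 → ν {P | t < σ * Z P} ≤
      ENNReal.ofReal (Real.exp (-(n * t ^ 2 / 2))) * m := by
    intro σ hσ
    have h1 := mul_meas_ge_le_lintegral (μ := ν)
      (f := fun P => ENNReal.ofReal (Real.exp ((n * t * σ) * Z P)))
      (by fun_prop) (ENNReal.ofReal (Real.exp (n * t ^ 2)))
    have h2 : {P | t < σ * Z P} ⊆ {P | ENNReal.ofReal (Real.exp (n * t ^ 2)) ≤
        ENNReal.ofReal (Real.exp ((n * t * σ) * Z P))} := by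
      intro P hP
      simp only [Set.mem_ofPred_eq] at hP ⊢
      apply ENNReal.ofReal_le_ofReal
      apply Real.exp_le_exp.2
      have : n * t * t ≤ n * t * (σ * Z P) := by gcongr
      linarith
    have h3 : ENNReal.ofReal (Real.exp (n * t ^ 2)) * ν {P | t < σ * Z P} ≤
        ENNReal.ofReal (Real.exp ((n * t * σ) ^ 2 / (2 * n))) * m :=
      (mul_le_mul_right (measure_mono h2) _).trans (h1.trans (h _))
    have h4 : (n * t * σ) ^ 2 / (2 * n) = n * t ^ 2 / 2 := by
      rw [mul_pow, hσ]; field_simp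
    rw [h4] at h3
    have h5 := mul_le_mul_right h3 (ENNReal.ofReal (Real.exp (-(n * t ^ 2))))
    rw [← mul_assoc, ← mul_assoc, ← ENNReal.ofReal_mul (Real.exp_pos _).le,
      ← ENNReal.ofReal_mul (Real.exp_pos _).le, ← Real.exp_add, ← Real.exp_add] at h5
    simp only [neg_add_cancel, Real.exp_zero, ENNReal.ofReal_one, one_mul] at h5
    convert h5 using 4
    ring
  have hs : {P | t < |Z P|} ⊆ {P | t < 1 * Z P} ∪ {P | t < (-1) * Z P} := by
    intro P hP
    simp only [Set.mem_ofPred_eq, lt_abs, Set.mem_union] at hP ⊢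
    simpa using hP
  refine (measure_mono hs).trans ((measure_union_le _ _).trans ?_)
  refine (add_le_add (one 1 (by norm_num)) (one (-1) (by norm_num))).trans (le_of_eq ?_)
  rw [ENNReal.ofReal_mul (by norm_num)]
  simp; ring

lemma mgf_coord {D : ℕ} (hD : 0 < D) (μ : Measure (Matrix.orthogonalGroup (Fin D) ℝ))
    [μ.IsMulLeftInvariant] [IsProbabilityMeasure μ] (o z : EuclideanSpace ℝ (Fin D))
    (ho : ‖o‖ = 1) (hz : ‖z‖ = 1) (s : ℝ) :
    ∫⁻ P, ENNReal.ofReal (Real.exp (s * ⟪ra P z, o⟫)) ∂μ ≤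
      ENNReal.ofReal (Real.exp (s ^ 2 / (2 * D))) := by
  have hD' : (0 : ℝ) < D := by exact_mod_cast hD
  have hb := (EuclideanSpace.basisFun (Fin D) ℝ).orthonormal
  have := mgf_inv hD μ Set.univ MeasurableSet.univ (fun P => ra P z)
    (ra_continuous z).measurable (fun P => by rw [ra_norm, hz]) (fun _ => True)
    (by simp) (fun Q _ P => ra_mul Q P z) o o (fun _ => rfl) 1 zero_le_one le_rfl
    _ hb ?_ s
  · simpa using this
  intro ε
  obtain ⟨Q, hQ, -⟩ := exists_refl o ((1 / Real.sqrt D) •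
      ∑ i, sg (ε i) • (EuclideanSpace.basisFun (Fin D) ℝ) i) (by
    rw [norm_smul, sg_norm _ hb, ho, Real.norm_of_nonneg (by positivity)]
    field_simp)
  exact ⟨Q, trivial, hQ⟩

lemma tail_pointwise (M X : ℝ) (hM : 0 ≤ M) :
    (if M < |X| then X ^ 2 else 0) ≤
      2 * Real.exp (-(M ^ 2 / 2)) * Real.exp ((1 + M / 2) * X) +
      2 * Real.exp (-(M ^ 2 / 2)) * Real.exp (-(1 + M / 2) * X) := by
  split_ifs with h
  · have h0 : X ^ 2 ≤ 2 * Real.exp |X| := by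
      have := Real.quadratic_le_exp_of_nonneg (abs_nonneg X)
      rw [sq_abs] at this
      nlinarith [abs_nonneg X]
    have h1 : Real.exp |X| ≤ Real.exp (-(M ^ 2 / 2)) * Real.exp ((1 + M / 2) * |X|) := by
      rw [← Real.exp_add]
      apply Real.exp_le_exp.2
      nlinarith
    have p1 := Real.exp_pos ((1 + M / 2) * X)
    have p2 := Real.exp_pos (-(1 + M / 2) * X)
    have p3 := Real.exp_pos (-(M ^ 2 / 2))
    rcases abs_choice X with hx | hx
    · rw [hx] at h1 h0
      nlinarith [mul_pos p3 p2]
    · rw [hx] at h1 h0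
      rw [show (1 + M / 2) * -X = -(1 + M / 2) * X by ring] at h1
      nlinarith [mul_pos p3 p1]
  · positivity

lemma coord_eq {D : ℕ} (P : Matrix.orthogonalGroup (Fin D) ℝ) (o : EuclideanSpace ℝ (Fin D))
    (i : Fin D) : Matrix.toEuclideanLin (P : Matrix (Fin D) (Fin D) ℝ)ᵀ o i =
      ⟪ra P (EuclideanSpace.single i 1), o⟫ := by
  rw [ra_inner_T, EuclideanSpace.inner_single_left]
  simp

lemma tail_coord {D : ℕ} (hD : 0 < D) (μ : Measure (Matrix.orthogonalGroup (Fin D) ℝ))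
    [μ.IsMulLeftInvariant] [IsProbabilityMeasure μ] (o z : EuclideanSpace ℝ (Fin D))
    (ho : ‖o‖ = 1) (hz : ‖z‖ = 1) (M : ℝ) (hM : 0 < M) :
    ∫⁻ P, ENNReal.ofReal (if M < Real.sqrt D * |⟪ra P z, o⟫| then ⟪ra P z, o⟫ ^ 2 else 0) ∂μ ≤
      ENNReal.ofReal (25 / 2 * Real.exp (-(M ^ 2 / 4)) / D) := by
  have hD' : (0 : ℝ) < D := by exact_mod_cast hD
  have hDs := Real.sqrt_pos.2 hD'
  have hD2 := Real.sq_sqrt hD'.le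
  set a := 1 + M / 2
  set K := 2 * Real.exp (-(M ^ 2 / 2)) / D with hK
  have hK0 : 0 ≤ K := by positivity
  have hm := (ra_continuous z).measurable
  have h1 : ∀ P, ENNReal.ofReal
      (if M < Real.sqrt D * |⟪ra P z, o⟫| then ⟪ra P z, o⟫ ^ 2 else 0) ≤
      ENNReal.ofReal K * ENNReal.ofReal (Real.exp ((a * Real.sqrt D) * ⟪ra P z, o⟫)) +
      ENNReal.ofReal K * ENNReal.ofReal (Real.exp ((-a * Real.sqrt D) * ⟪ra P z, o⟫)) := by
    intro P
    rw [← ENNReal.ofReal_mul hK0, ← ENNReal.ofReal_mul hK0,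
      ← ENNReal.ofReal_add (by positivity) (by positivity)]
    apply ENNReal.ofReal_le_ofReal
    have := tail_pointwise M (Real.sqrt D * ⟪ra P z, o⟫) hM.le
    rw [abs_mul, abs_of_pos hDs] at this
    have e : (if M < Real.sqrt D * |⟪ra P z, o⟫| then (Real.sqrt D * ⟪ra P z, o⟫) ^ 2 else 0) =
      D * (if M < Real.sqrt D * |⟪ra P z, o⟫| then ⟪ra P z, o⟫ ^ 2 else 0) := by
      split_ifs
      · rw [mul_pow, hD2]
      · simp
    rw [e, show 1 + M / 2 = a from rfl] at this
    refine le_of_mul_le_mul_left (this.trans (le_of_eq ?_)) hD'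
    rw [hK, mul_assoc a, mul_assoc (-a)]
    field_simp
  refine (lintegral_mono h1).trans ?_
  rw [lintegral_add_left (by fun_prop), lintegral_const_mul _ (by fun_prop),
    lintegral_const_mul _ (by fun_prop)]
  refine (add_le_add (mul_le_mul_right (mgf_coord hD μ o z ho hz _) _)
    (mul_le_mul_right (mgf_coord hD μ o z ho hz _) _)).trans ?_
  rw [← ENNReal.ofReal_mul hK0, ← ENNReal.ofReal_mul hK0,
      ← ENNReal.ofReal_add (by positivity) (by positivity)]
  apply ENNReal.ofReal_le_ofReal
  have e1 : (a * Real.sqrt D) ^ 2 / (2 * D) = a ^ 2 / 2 := by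
    rw [mul_pow, hD2]; field_simp
  have e2 : (-a * Real.sqrt D) ^ 2 / (2 * D) = a ^ 2 / 2 := by
    rw [mul_pow, hD2]; field_simp
  rw [e1, e2]
  have e3 : Real.exp (-(M ^ 2 / 2)) * Real.exp (a ^ 2 / 2) ≤
      Real.exp 1 * Real.exp (-(M ^ 2 / 4)) := by
    rw [← Real.exp_add, ← Real.exp_add]
    apply Real.exp_le_exp.2
    simp only [a]
    nlinarith [sq_nonneg (M / 2 - 1)]
  have e4 : Real.exp 1 ≤ 25 / 8 := by have := Real.exp_one_lt_d9; linarith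
  have e5 := Real.exp_pos (-(M ^ 2 / 4))
  have e6 : Real.exp (-(M ^ 2 / 2)) * Real.exp (a ^ 2 / 2) ≤ 25 / 8 * Real.exp (-(M ^ 2 / 4)) := by
    nlinarith
  rw [hK]
  calc _ = 4 * (Real.exp (-(M ^ 2 / 2)) * Real.exp (a ^ 2 / 2)) / D := by ring
    _ ≤ 4 * (25 / 8 * Real.exp (-(M ^ 2 / 4))) / D := by gcongr
    _ = _ := by ring

lemma tail_markov {D : ℕ} (hD : 0 < D) (μ : Measure (Matrix.orthogonalGroup (Fin D) ℝ))
    [μ.IsMulLeftInvariant] [IsProbabilityMeasure μ] (o : EuclideanSpace ℝ (Fin D))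
    (ho : ‖o‖ = 1) (M : ℝ) (hM : 0 < M) (δ : ℝ) (hδ : 0 < δ) :
    μ {P | 25 / 2 * Real.exp (-(M ^ 2 / 4)) / δ <
      tail M (Matrix.toEuclideanLin (P : Matrix (Fin D) (Fin D) ℝ)ᵀ o)} ≤ ENNReal.ofReal δ := by
  have hD' : (0 : ℝ) < D := by exact_mod_cast hD
  set C := 25 / 2 * Real.exp (-(M ^ 2 / 4)) with hC
  have hC0 : 0 < C := by positivity
  have hm : ∀ z : EuclideanSpace ℝ (Fin D), Measurable fun P : Matrix.orthogonalGroup (Fin D) ℝ =>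
      ENNReal.ofReal (if M < Real.sqrt D * |⟪ra P z, o⟫| then ⟪ra P z, o⟫ ^ 2 else 0) := by
    intro z
    have hm := (ra_continuous z).measurable
    apply Measurable.ennreal_ofReal
    apply Measurable.ite
    · apply measurableSet_lt <;> fun_prop
    · fun_prop
    · fun_prop
  have hE : ∀ P : Matrix.orthogonalGroup (Fin D) ℝ,
      ENNReal.ofReal (tail M (Matrix.toEuclideanLin (P : Matrix (Fin D) (Fin D) ℝ)ᵀ o)) =
      ∑ i : Fin D, ENNReal.ofReal (if M < Real.sqrt D *
        |⟪ra P (EuclideanSpace.single i 1), o⟫| then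
          ⟪ra P (EuclideanSpace.single i 1), o⟫ ^ 2 else 0) := by
    intro P
    rw [tail, ENNReal.ofReal_sum_of_nonneg (fun i _ => by split_ifs <;> positivity)]
    simp_rw [coord_eq]
  have h1 : ∫⁻ P : Matrix.orthogonalGroup (Fin D) ℝ, ENNReal.ofReal
      (tail M (Matrix.toEuclideanLin (P : Matrix (Fin D) (Fin D) ℝ)ᵀ o)) ∂μ
      ≤ ENNReal.ofReal C := by
    simp_rw [hE]
    rw [lintegral_finsetSum _ (fun i _ => hm _)]
    refine (Finset.sum_le_sum fun i _ => tail_coord hD μ o _ ho (by simp) M hM).trans ?_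
    rw [← hC]
    simp only [Finset.sum_const, Finset.card_univ, Fintype.card_fin, nsmul_eq_mul]
    rw [← ENNReal.ofReal_natCast, ← ENNReal.ofReal_mul hD'.le]
    apply le_of_eq; congr 1; field_simp
  have hmeas : Measurable fun P : Matrix.orthogonalGroup (Fin D) ℝ => ENNReal.ofReal
      (tail M (Matrix.toEuclideanLin (P : Matrix (Fin D) (Fin D) ℝ)ᵀ o)) := by
    simp_rw [hE]
    exact Finset.measurable_fun_sum _ (fun i _ => hm _)
  have h2 := (mul_meas_ge_le_lintegral (μ := μ) hmeas (ENNReal.ofReal (C / δ))).trans h1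
  have h3 : ENNReal.ofReal (C / δ) * μ {P | C / δ <
      tail M (Matrix.toEuclideanLin (P : Matrix (Fin D) (Fin D) ℝ)ᵀ o)} ≤
      ENNReal.ofReal (C / δ) * ENNReal.ofReal δ := by
    rw [← ENNReal.ofReal_mul (by positivity), div_mul_cancel₀ _ hδ.ne']
    refine le_trans ?_ h2
    refine mul_le_mul_right (measure_mono ?_) _
    intro P hP
    exact ENNReal.ofReal_le_ofReal (le_of_lt hP)
  exact (ENNReal.mul_le_mul_iff_right (by simp; positivity) (by simp)).1 h3

lemma null_hyper {D : ℕ} (μ : Measure (Matrix.orthogonalGroup (Fin D) ℝ))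
    [μ.IsMulLeftInvariant] [IsProbabilityMeasure μ] (o z : EuclideanSpace ℝ (Fin D))
    (ho : ‖o‖ = 1) (hz : z ≠ 0) : μ {P | ⟪ra P z, o⟫ = 0} = 0 := by
  have hD : 0 < D := by
    rcases Nat.eq_zero_or_pos D with rfl | h
    · exact absurd (Subsingleton.elim z 0) hz
    · exact h
  let w : ℕ → EuclideanSpace ℝ (Fin D) := fun k => WithLp.toLp 2 fun i => (k : ℝ) ^ (i : ℕ)
  have hw : ∀ k, w k ≠ 0 := by
    intro k h
    have : w k ⟨0, hD⟩ = 0 := by rw [h]; rfl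
    simp [w] at this
  have hset : ∀ k, μ {P | ⟪ra P z, w k⟫ = 0} = μ {P | ⟪ra P z, o⟫ = 0} := by
    intro k
    have hk := norm_pos_iff.2 (hw k)
    obtain ⟨Q, hQ, -⟩ := exists_refl o (‖w k‖⁻¹ • w k) (by
      rw [norm_smul, norm_inv, norm_norm, ho]; field_simp)
    rw [← measure_preimage_mul μ Q]
    congr 1
    ext P
    have : w k = ‖w k‖ • ra Q o := by rw [hQ, smul_smul]; field_simp; simp
    simp only [Set.mem_preimage, Set.mem_ofPred_eq]
    rw [this, ra_mul, inner_smul_right, ra_inner]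
    simp [hw k]
  have hms : ∀ k, MeasurableSet {P : Matrix.orthogonalGroup (Fin D) ℝ | ⟪ra P z, w k⟫ = 0} := by
    intro k
    have hm := (ra_continuous z).measurable
    exact measurableSet_eq_fun (by fun_prop) (by fun_prop)
  set p := μ {P | ⟪ra P z, o⟫ = 0} with hp
  have hcount : ∀ (N : ℕ) (P : Matrix.orthogonalGroup (Fin D) ℝ),
      ∑ k ∈ Finset.range N, ({P | ⟪ra P z, w k⟫ = 0} :
        Set (Matrix.orthogonalGroup (Fin D) ℝ)).indicator (fun _ => (1 : ENNReal)) P ≤ D := by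
    intro N P
    classical
    simp only [Set.indicator_apply, Set.mem_ofPred_eq]
    rw [Finset.sum_boole]
    norm_cast
    set x := ra P z with hx
    have hx0 : x ≠ 0 := by
      intro h
      have := ra_norm P z
      rw [← hx, h, norm_zero] at this
      exact hz (norm_eq_zero.1 this.symm)
    let f : Polynomial ℝ := ∑ i : Fin D, Polynomial.C (x i) * Polynomial.X ^ (i : ℕ)
    have hf : f ≠ 0 := by
      intro h
      apply hx0
      ext j
      have : f.coeff j = x j := by
        simp [f, Polynomial.finsetSum_coeff, Polynomial.coeff_X_pow, Fin.val_inj]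
      rw [← this, h]; simp
    have hdeg : f.natDegree ≤ D := by
      apply Polynomial.natDegree_sum_le_of_forall_le
      intro i _
      exact (Polynomial.natDegree_C_mul_X_pow_le _ _).trans i.2.le
    have hev : ∀ k : ℕ, f.eval (k : ℝ) = ⟪x, w k⟫ := by
      intro k
      rw [PiLp.inner_apply]
      simp only [f, w, Polynomial.eval_finsetSum, Polynomial.eval_mul, Polynomial.eval_C,
        Polynomial.eval_pow, Polynomial.eval_X]
      apply Finset.sum_congr rfl
      intro i _
      simp [mul_comm]
    rw [← Finset.card_image_of_injective _ (Nat.cast_injective (R := ℝ))]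
    refine (Polynomial.card_le_degree_of_subset_roots (p := f) ?_).trans hdeg
    intro a ha
    simp only [Finset.image_val, Multiset.mem_dedup, Multiset.mem_map] at ha
    obtain ⟨k, hk, rfl⟩ := ha
    rw [Polynomial.mem_roots hf, Polynomial.IsRoot, hev]
    have hk' := (Finset.mem_filter (s := Finset.range N) (p := fun k => ⟪x, w k⟫ = 0)).1 hk
    exact hk'.2
  have hN : ∀ N : ℕ, (N : ENNReal) * p ≤ D := by
    intro N
    calc (N : ENNReal) * p = ∑ k ∈ Finset.range N, μ {P | ⟪ra P z, w k⟫ = 0} := by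
          simp [hset]
      _ = ∫⁻ P, ∑ k ∈ Finset.range N, ({P | ⟪ra P z, w k⟫ = 0} :
        Set (Matrix.orthogonalGroup (Fin D) ℝ)).indicator (fun _ => (1 : ENNReal)) P ∂μ := by
          rw [lintegral_finsetSum _ (fun k _ => measurable_const.indicator (hms k))]
          apply Finset.sum_congr rfl
          intro k _
          rw [lintegral_indicator (hms k)]; simp
      _ ≤ ∫⁻ P, (D : ENNReal) ∂μ := lintegral_mono fun P => hcount N P
      _ = D := by simp
  by_contra hp0
  obtain ⟨N, hN'⟩ := ENNReal.exists_nat_mul_gt hp0 (ENNReal.natCast_ne_top D)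
  exact absurd (hN N) (not_le.2 hN')

/-- residual direction -/
def resid {D : ℕ} (o v : EuclideanSpace ℝ (Fin D)) (P : Matrix.orthogonalGroup (Fin D) ℝ) :
    EuclideanSpace ℝ (Fin D) := ra P v - ⟪ra P v, o⟫ • o

lemma resid_tail {D : ℕ} (hD : 2 ≤ D) (μ : Measure (Matrix.orthogonalGroup (Fin D) ℝ))
    [μ.IsMulLeftInvariant] (o q v : EuclideanSpace ℝ (Fin D)) (ho : ‖o‖ = 1) (hq : ‖q‖ = 1)
    (A : Set (Matrix.orthogonalGroup (Fin D) ℝ)) (hA : MeasurableSet A)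
    (hpA : ∀ Q : Matrix.orthogonalGroup (Fin D) ℝ, ra Q o = o → ∀ P, Q * P ∈ A ↔ P ∈ A)
    (t : ℝ) (ht : 0 ≤ t) :
    μ (A ∩ {P | t < |⟪‖resid o v P‖⁻¹ • resid o v P, q⟫|}) ≤
      ENNReal.ofReal (2 * Real.exp (-(((D - 1 : ℕ) : ℝ) * t ^ 2 / 2))) * μ A := by
  set X : Matrix.orthogonalGroup (Fin D) ℝ → EuclideanSpace ℝ (Fin D) :=
    fun P => ‖resid o v P‖⁻¹ • resid o v P with hXdef
  have hn : 0 < D - 1 := by omega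
  have hn' : (0 : ℝ) < ((D - 1 : ℕ) : ℝ) := by exact_mod_cast hn
  have hrm : Measurable (resid o v) := by
    have hm := (ra_continuous v).measurable
    unfold resid
    fun_prop
  have hXm : Measurable X := by
    simp only [X]; fun_prop
  have hoo : ⟪o, o⟫ = 1 := by rw [real_inner_self_eq_norm_sq, ho]; norm_num
  have hro : ∀ P, ⟪resid o v P, o⟫ = 0 := by
    intro P
    rw [resid, inner_sub_left, inner_smul_left, hoo]; simp
  have hXo : ∀ P, ⟪X P, o⟫ = 0 := by
    intro P
    simp only [X]
    rw [inner_smul_left, hro, mul_zero]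
  have hX1 : ∀ P, ‖X P‖ ≤ 1 := by
    intro P
    simp only [X]
    rw [norm_smul, norm_inv, norm_norm]
    exact inv_mul_le_one
  have hres : ∀ Q : Matrix.orthogonalGroup (Fin D) ℝ, ra Q o = o → ∀ P,
      resid o v (Q * P) = ra Q (resid o v P) := by
    intro Q hQ P
    unfold resid
    rw [map_sub, map_smul, hQ, ra_mul]
    congr 2
    conv_lhs => rw [← hQ]
    rw [ra_inner]
  have hpX : ∀ Q : Matrix.orthogonalGroup (Fin D) ℝ, ra Q o = o → ∀ P,
      X (Q * P) = ra Q (X P) := by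
    intro Q hQ P
    simp only [X]
    rw [hres Q hQ, ra_norm, map_smul]
  set q' := q - ⟪o, q⟫ • o with hq'
  have hoq' : ⟪o, q'⟫ = 0 := by
    rw [hq', inner_sub_right, inner_smul_right, hoo]; simp
  have hqq : ∀ P, ⟪X P, q⟫ = ⟪X P, q'⟫ := by
    intro P
    rw [hq', inner_sub_right, inner_smul_right, hXo]; simp
  have hr : ‖q'‖ ≤ 1 := by
    have : ‖q'‖ ^ 2 = 1 - ⟪o, q⟫ ^ 2 := by
      rw [← real_inner_self_eq_norm_sq, hq', inner_sub_left, ← hq', inner_smul_left, hoq', hq',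
        inner_sub_right, inner_smul_right, real_inner_self_eq_norm_sq, hq, real_inner_comm]
      simp; ring
    nlinarith [norm_nonneg q', sq_nonneg ⟪o, q⟫]
  -- basis
  obtain ⟨b, hb, hbo⟩ : ∃ b : Fin (D - 1) → EuclideanSpace ℝ (Fin D), Orthonormal ℝ b ∧
      ∀ i, ⟪o, b i⟫ = 0 := by
    have ho0 : o ≠ 0 := by intro h; rw [h, norm_zero] at ho; norm_num at ho
    have hfr : Module.finrank ℝ (Submodule.span ℝ {o})ᗮ = D - 1 := by
      have : Fact (Module.finrank ℝ (EuclideanSpace ℝ (Fin D)) = (D - 1) + 1) :=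
        ⟨by rw [finrank_euclideanSpace_fin]; omega⟩
      exact Submodule.finrank_orthogonal_span_singleton ho0
    let B := (stdOrthonormalBasis ℝ (Submodule.span ℝ {o})ᗮ).reindex (finCongr hfr)
    refine ⟨fun i => (B i : EuclideanSpace ℝ (Fin D)), ?_, ?_⟩
    · exact B.orthonormal.comp_linearIsometry (Submodule.span ℝ {o})ᗮ.subtypeₗᵢ
    · intro i
      exact Submodule.mem_orthogonal_singleton_iff_inner_right.1 (B i).2
  have hmgf := fun s => mgf_inv hn μ A hA X hXm hX1 (fun Q => ra Q o = o) hpA hpX q q' hqq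
    ‖q'‖ (norm_nonneg _) hr b hb (by
      intro ε
      obtain ⟨Q, h1, h2⟩ := exists_refl q'
        ((‖q'‖ / Real.sqrt ((D - 1 : ℕ) : ℝ)) • ∑ i, sg (ε i) • b i) (by
          rw [norm_smul, sg_norm b hb, Real.norm_of_nonneg (by positivity)]
          have := Real.sqrt_pos.2 hn'
          field_simp)
      refine ⟨Q, h2 o ?_, h1⟩
      rw [hoq', inner_smul_right, inner_sum]
      simp [inner_smul_right, hbo]) s
  have := tail_inv (μ.restrict A) (D - 1) hn (μ A) (fun P => ⟪X P, q⟫) (by fun_prop) hmgf t ht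
  have hms : MeasurableSet {P | t < |⟪X P, q⟫|} := by
    apply measurableSet_lt <;> fun_prop
  rw [Measure.restrict_apply hms] at this
  rwa [Set.inter_comm]

lemma final_scalar (B : ℕ) (hB : 1 ≤ B) (δ L M τ : ℝ) (hδ0 : 0 < δ) (hδ1 : δ < 1) (hL : 0 < L)
    (hM : M = max (L / 8) (2 * Real.sqrt (Real.log (25 / δ)))) (hτ0 : 0 ≤ τ)
    (hτ : τ ≤ 25 / 2 * Real.exp (-(M ^ 2 / 4)) / δ) :
    τ ≤ 1 / 2 ∧ 8 * (M / 2 ^ B + Real.sqrt τ) ≤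
      L / 2 ^ B + 1000 / Real.sqrt δ * Real.exp (-((1 / 512) / 2) * L ^ 2) := by
  set x := 25 / δ with hx
  have hx1 : 1 ≤ x := by rw [hx, le_div_iff₀ hδ0]; linarith
  have hx0 : 0 < x := by linarith
  have hlog0 : 0 ≤ Real.log x := Real.log_nonneg hx1
  have hsq := Real.sq_sqrt hlog0
  have hs0 := Real.sqrt_nonneg (Real.log x)
  have hM1 : L / 8 ≤ M := hM ▸ le_max_left _ _
  have hM2 : 2 * Real.sqrt (Real.log x) ≤ M := hM ▸ le_max_right _ _
  have hMsq : Real.log x ≤ M ^ 2 / 4 := by nlinarith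
  have hτx : τ ≤ x / 2 * Real.exp (-(M ^ 2 / 4)) := by
    refine hτ.trans (le_of_eq ?_); rw [hx]; ring
  have hex : Real.exp (-(M ^ 2 / 4)) ≤ x⁻¹ := by
    rw [← Real.exp_log (inv_pos.2 hx0), Real.log_inv]
    exact Real.exp_le_exp.2 (by linarith)
  have hhalf : τ ≤ 1 / 2 := by
    refine hτx.trans ?_
    calc x / 2 * Real.exp (-(M ^ 2 / 4)) ≤ x / 2 * x⁻¹ := by gcongr
      _ = 1 / 2 := by field_simp
  refine ⟨hhalf, ?_⟩
  have hsx : 1000 / Real.sqrt δ = 200 * Real.sqrt x := by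
    rw [hx, Real.sqrt_div (by norm_num), show (25 : ℝ) = 5 ^ 2 by norm_num,
      Real.sqrt_sq (by norm_num)]; ring
  rw [hsx]
  have h2B : (2 : ℝ) ≤ 2 ^ B := by
    calc (2 : ℝ) = 2 ^ 1 := by norm_num
      _ ≤ 2 ^ B := pow_le_pow_right₀ (by norm_num) hB
  rcases le_total (2 * Real.sqrt (Real.log x)) (L / 8) with hc | hc
  · have hML : M = L / 8 := by rw [hM, max_eq_left hc]
    have h1 : Real.sqrt τ ≤ Real.sqrt x * Real.exp (-((1 / 512) / 2) * L ^ 2) := by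
      rw [Real.sqrt_le_iff]
      refine ⟨by positivity, ?_⟩
      rw [mul_pow, Real.sq_sqrt hx0.le, ← Real.exp_nat_mul]
      refine hτx.trans ?_
      have : Real.exp (-(M ^ 2 / 4)) ≤ Real.exp ((2 : ℕ) * (-((1 / 512) / 2) * L ^ 2)) := by
        apply Real.exp_le_exp.2
        rw [hML]; push_cast; nlinarith [sq_nonneg L]
      have hp := Real.exp_pos (-(M ^ 2 / 4))
      nlinarith
    have h2 : 8 * (M / 2 ^ B) = L / 2 ^ B := by rw [hML]; ring
    have h3 : 0 ≤ Real.sqrt x * Real.exp (-((1 / 512) / 2) * L ^ 2) := by positivity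
    nlinarith
  · have hML : M = 2 * Real.sqrt (Real.log x) := by rw [hM, max_eq_right hc]
    set w := Real.sqrt (Real.sqrt x) with hw
    have hw2 : w ^ 2 = Real.sqrt x := Real.sq_sqrt (Real.sqrt_nonneg x)
    have hx2 : Real.sqrt x ^ 2 = x := Real.sq_sqrt hx0.le
    have hw1 : 1 ≤ w := by
      rw [hw]; apply Real.one_le_sqrt.2; exact Real.one_le_sqrt.2 hx1
    have hw0 : 0 < w := by linarith
    have hlogw : Real.log x = 4 * Real.log w := by
      rw [← hx2, ← hw2, ← pow_mul, Real.log_pow]; push_cast; ring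
    have hlw : Real.log x ≤ 2 * w ^ 2 := by
      have : Real.log (Real.sqrt x) = Real.log x / 2 := Real.log_sqrt hx0.le
      have h := Real.log_le_sub_one_of_pos (Real.sqrt_pos.2 hx0)
      rw [this] at h
      rw [hw2]; linarith
    have hsl : Real.sqrt (Real.log x) ≤ 2 * w := by
      rw [Real.sqrt_le_iff]; refine ⟨by positivity, ?_⟩
      nlinarith
    have hexL : w⁻¹ ≤ Real.exp (-((1 / 512) / 2) * L ^ 2) := by
      rw [← Real.exp_log (inv_pos.2 hw0), Real.log_inv]
      apply Real.exp_le_exp.2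
      have : (L / 8) ^ 2 ≤ 4 * Real.log x := by nlinarith
      nlinarith
    have h1 : 200 * w ≤ 200 * Real.sqrt x * Real.exp (-((1 / 512) / 2) * L ^ 2) := by
      calc 200 * w = 200 * w ^ 2 * w⁻¹ := by field_simp
        _ = 200 * Real.sqrt x * w⁻¹ := by rw [hw2]
        _ ≤ _ := by gcongr
    have h2 : M / 2 ^ B ≤ 2 * w := by
      rw [div_le_iff₀ (by positivity), hML]
      nlinarith
    have h3 : Real.sqrt τ ≤ 1 := by
      rw [Real.sqrt_le_iff]; constructor <;> linarith
    have h4 : 0 ≤ L / 2 ^ B := by positivity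
    linarith

lemma grid_finite (D B : ℕ) : (gridSet D B).Finite := by
  refine (Set.finite_range (fun u : Fin D → Fin (2 ^ B) =>
    (WithLp.toLp 2 fun i => -((2 ^ B : ℝ) - 1) / 2 + ((u i : ℕ) : ℝ) :
      EuclideanSpace ℝ (Fin D)))).subset ?_
  intro y hy
  choose u hu h using hy
  refine ⟨fun i => ⟨u i, hu i⟩, ?_⟩
  ext i
  simp [h i]

/-- there are absolute constants `c₀, c₁ > 0` such that for unit vectors
`o, q`, a Haar-random orthogonal `P`, and any choice `ȳ(P)` of cosine maximizer of `Pᵀo` over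
`𝒢`, setting `ō = P·ȳ/‖ȳ‖`, with probability at least `1 − 2δ`,
`|⟨ō, q⟩/⟨ō, o⟩ − ⟨o, q⟩| ≤ (L/2^B + (c₁/√δ)·exp(−(c₀/2)L²))·√(log(1/δ)/(c₀(D−1)))`. -/
theorem extended_rabitq_error_bound :
    ∃ c₀ : ℝ, 0 < c₀ ∧ ∃ c₁ : ℝ, 0 < c₁ ∧
      ∀ (D B : ℕ), 2 ≤ D → 1 ≤ B →
      ∀ (o q : EuclideanSpace ℝ (Fin D)), ‖o‖ = 1 → ‖q‖ = 1 →
      ∀ (δ : ℝ), δ ∈ Set.Ioo (0 : ℝ) 1 → ∀ (L : ℝ), 0 < L →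
      ∀ (μ : Measure (Matrix.orthogonalGroup (Fin D) ℝ)),
        μ.IsHaarMeasure → IsProbabilityMeasure μ →
      ∀ (ybar : Matrix.orthogonalGroup (Fin D) ℝ → EuclideanSpace ℝ (Fin D)),
        (∀ P : Matrix.orthogonalGroup (Fin D) ℝ,
          IsCosineMaximizer D B
            (Matrix.toEuclideanLin (P : Matrix (Fin D) (Fin D) ℝ)ᵀ o) (ybar P)) →
        ENNReal.ofReal (1 - 2 * δ) ≤
          μ {P : Matrix.orthogonalGroup (Fin D) ℝ |
              |⟪quantized D (P : Matrix (Fin D) (Fin D) ℝ) (ybar P), q⟫ /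
                    ⟪quantized D (P : Matrix (Fin D) (Fin D) ℝ) (ybar P), o⟫ - ⟪o, q⟫| ≤
                (L / 2 ^ B + c₁ / Real.sqrt δ * Real.exp (-(c₀ / 2) * L ^ 2)) *
                  Real.sqrt (Real.log (1 / δ) / (c₀ * ((D : ℝ) - 1)))} := by

  refine ⟨1 / 512, by norm_num, 1000, by norm_num, ?_⟩
  intro D B hD hB o q ho hq δ hδ L hL μ hμ hμp ybar hy
  obtain ⟨hδ0, hδ1⟩ := hδ
  rcases le_or_gt (1 / 2) δ with hδh | hδh
  · rw [ENNReal.ofReal_of_nonpos (by linarith)]; exact zero_le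
  have hD0 : 0 < D := by omega
  set G := {P : Matrix.orthogonalGroup (Fin D) ℝ |
              |⟪quantized D (P : Matrix (Fin D) (Fin D) ℝ) (ybar P), q⟫ /
                    ⟪quantized D (P : Matrix (Fin D) (Fin D) ℝ) (ybar P), o⟫ - ⟪o, q⟫| ≤
                (L / 2 ^ B + 1000 / Real.sqrt δ * Real.exp (-(1 / 512 / 2) * L ^ 2)) *
                  Real.sqrt (Real.log (1 / δ) / (1 / 512 * ((D : ℝ) - 1)))} with hG
  have hD1 : ((D - 1 : ℕ) : ℝ) = (D : ℝ) - 1 := by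
    rw [Nat.cast_sub (by omega)]; simp
  have hDp : 0 < (D : ℝ) - 1 := by
    have : (2 : ℝ) ≤ D := by exact_mod_cast hD
    linarith
  have hlog : 0 < Real.log (1 / δ) := Real.log_pos (by rw [lt_div_iff₀ hδ0]; linarith)
  set t := Real.sqrt (Real.log (1 / δ) / (1 / 512 * ((D : ℝ) - 1))) with ht
  have ht0 : 0 ≤ t := Real.sqrt_nonneg _
  have ht2 : t ^ 2 = Real.log (1 / δ) / (1 / 512 * ((D : ℝ) - 1)) :=
    Real.sq_sqrt (by positivity)
  set M := max (L / 8) (2 * Real.sqrt (Real.log (25 / δ))) with hM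
  have hM0 : 0 < M := lt_of_lt_of_le (by positivity) (le_max_left _ _)
  -- directions
  let V : Finset (EuclideanSpace ℝ (Fin D)) :=
    ((grid_finite D B).image (fun y => ‖y‖⁻¹ • y)).toFinset
  have hV : ∀ v, v ∈ V ↔ ∃ y ∈ gridSet D B, ‖y‖⁻¹ • y = v := by
    intro v; simp [V]
  let A : EuclideanSpace ℝ (Fin D) → Set (Matrix.orthogonalGroup (Fin D) ℝ) :=
    fun v => {P | ∀ w ∈ V, ⟪ra P w, o⟫ ≤ ⟪ra P v, o⟫}
  have hAm : ∀ v, MeasurableSet (A v) := by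
    intro v
    have : A v = ⋂ w ∈ V, {P | ⟪ra P w, o⟫ ≤ ⟪ra P v, o⟫} := by
      ext P; simp [A]
    rw [this]
    refine Finset.measurableSet_biInter _ fun w _ => ?_
    have h1 := (ra_continuous w).measurable
    have h2 := (ra_continuous v).measurable
    exact measurableSet_le (by fun_prop) (by fun_prop)
  have hAinv : ∀ v, ∀ Q : Matrix.orthogonalGroup (Fin D) ℝ, ra Q o = o →
      ∀ P, Q * P ∈ A v ↔ P ∈ A v := by
    intro v Q hQ P
    have : ∀ w, ⟪ra (Q * P) w, o⟫ = ⟪ra P w, o⟫ := by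
      intro w
      conv_lhs => rw [← hQ]
      rw [ra_mul, ra_inner]
    simp only [A, Set.mem_ofPred_eq, this]
  have hAsum : ∑ v ∈ V, μ (A v) ≤ 1 := by
    rw [← measure_biUnion_finset₀]
    · exact prob_le_one
    · intro v _ w _ hvw
      refine measure_mono_null ?_ (null_hyper μ o (v - w) ho (sub_ne_zero.2 hvw))
      rintro P ⟨h1, h2⟩
      have a1 := h1 w (by assumption)
      have a2 := h2 v (by assumption)
      simp only [Set.mem_ofPred_eq, map_sub, inner_sub_left]
      linarith
    · intro v _; exact (hAm v).nullMeasurableSet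
  let T : EuclideanSpace ℝ (Fin D) → Set (Matrix.orthogonalGroup (Fin D) ℝ) :=
    fun v => {P | t < |⟪‖resid o v P‖⁻¹ • resid o v P, q⟫|}
  let S : Set (Matrix.orthogonalGroup (Fin D) ℝ) := {P | 25 / 2 * Real.exp (-(M ^ 2 / 4)) / δ <
      tail M (Matrix.toEuclideanLin (P : Matrix (Fin D) (Fin D) ℝ)ᵀ o)}
  have hS : μ S ≤ ENNReal.ofReal δ := tail_markov hD0 μ o ho M hM0 δ hδ0
  have hexp : 2 * Real.exp (-(((D - 1 : ℕ) : ℝ) * t ^ 2 / 2)) ≤ δ := by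
    have e : ((D - 1 : ℕ) : ℝ) * t ^ 2 / 2 = 256 * Real.log (1 / δ) := by
      rw [hD1, ht2]; field_simp; norm_num
    rw [e]
    have h1 : Real.exp (-(256 * Real.log (1 / δ))) ≤ Real.exp (2 * Real.log δ) := by
      apply Real.exp_le_exp.2
      rw [one_div, Real.log_inv] at hlog ⊢
      linarith
    have h2 : Real.exp (2 * Real.log δ) = δ ^ 2 := by
      rw [two_mul, Real.exp_add, Real.exp_log hδ0]; ring
    rw [h2] at h1
    nlinarith
  have hT : μ (⋃ v ∈ V, (A v ∩ T v)) ≤ ENNReal.ofReal δ := by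
    refine (measure_biUnion_finset_le _ _).trans ?_
    calc ∑ v ∈ V, μ (A v ∩ T v) ≤ ∑ v ∈ V, ENNReal.ofReal δ * μ (A v) := by
          refine Finset.sum_le_sum fun v _ => ?_
          refine (resid_tail hD μ o q v ho hq (A v) (hAm v) (hAinv v) t ht0).trans ?_
          gcongr
      _ = ENNReal.ofReal δ * ∑ v ∈ V, μ (A v) := by rw [Finset.mul_sum]
      _ ≤ ENNReal.ofReal δ * 1 := by gcongr
      _ = _ := mul_one _
  have hbad : Gᶜ ⊆ S ∪ ⋃ v ∈ V, (A v ∩ T v) := by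
    intro P hP
    by_contra hcon
    apply hP
    simp only [Set.mem_union, Set.mem_iUnion, not_or, not_exists] at hcon
    obtain ⟨hc1, hc2⟩ := hcon
    have hc1' : tail M (Matrix.toEuclideanLin (P : Matrix (Fin D) (Fin D) ℝ)ᵀ o) ≤
      25 / 2 * Real.exp (-(M ^ 2 / 4)) / δ := not_lt.1 hc1
    obtain ⟨hyg, hymax⟩ := hy P
    set v := ‖ybar P‖⁻¹ • ybar P with hv
    have hvV : v ∈ V := (hV v).2 ⟨ybar P, hyg, rfl⟩
    have hPA : P ∈ A v := by
      intro w hw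
      obtain ⟨y, hyy, rfl⟩ := (hV w).1 hw
      rw [ra_inner_T, ra_inner_T]
      exact hymax y hyy
    have hPT : |⟪‖resid o v P‖⁻¹ • resid o v P, q⟫| ≤ t :=
      not_lt.1 fun h => hc2 v hvV ⟨hPA, h⟩
    set u := Matrix.toEuclideanLin (P : Matrix (Fin D) (Fin D) ℝ)ᵀ o with hu
    have hu1 : ‖u‖ = 1 := by
      have h2 : ∀ x, ⟪ra P x, o⟫ = ⟪x, u⟫ := fun x => ra_inner_T P x o
      have h3 : ra P⁻¹ o = u := by
        refine ext_inner_left ℝ fun x => ?_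
        rw [← h2, ← ra_inner P, ← ra_mul]
        simp [ra]
      rw [← h3, ra_norm, ho]
    obtain ⟨hfs1, hfs2⟩ := final_scalar B hB δ L M (tail M u) hδ0 hδ1 hL hM (tail_nonneg M u) hc1'
    obtain ⟨hcp, htan⟩ := tan_bound hD0 hB u v hu1 M hM0 hfs1 hymax
    set R := L / 2 ^ B + 1000 / Real.sqrt δ * Real.exp (-(1 / 512 / 2) * L ^ 2) with hR
    have hvn : ‖v‖ = 1 := by
      have := norm_pos_iff.2 (grid_ne_zero hD0 hB _ hyg)
      rw [hv, norm_smul, norm_inv, norm_norm]; field_simp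
    set c := ⟪v, u⟫ with hc
    have hco : ⟪ra P v, o⟫ = c := ra_inner_T P v o
    have hrn : ‖resid o v P‖ = Real.sqrt (1 - c ^ 2) := by
      rw [norm_eq_sqrt_real_inner]
      congr 1
      rw [resid, hco, inner_sub_left, inner_sub_right, inner_sub_right, inner_smul_left,
        inner_smul_right, inner_smul_right, inner_smul_left, ra_inner, hco,
        real_inner_self_eq_norm_sq, real_inner_self_eq_norm_sq, real_inner_comm, hco, hvn, ho]
      simp; ring
    have hrq : |⟪resid o v P, q⟫| ≤ R * c * t := by
      have e : |⟪resid o v P, q⟫| =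
          ‖resid o v P‖ * |⟪‖resid o v P‖⁻¹ • resid o v P, q⟫| := by
        rcases eq_or_ne (resid o v P) 0 with h | h
        · rw [h]; simp
        · have := norm_pos_iff.2 h
          rw [inner_smul_left, abs_mul]
          simp; field_simp
      rw [e]
      apply mul_le_mul _ hPT (abs_nonneg _) _
      · rw [hrn]
        exact htan.trans (mul_le_mul_of_nonneg_right hfs2 hcp.le)
      · have : 0 ≤ R := by positivity
        positivity
    change |⟪ra P v, q⟫ / ⟪ra P v, o⟫ - ⟪o, q⟫| ≤ R * t
    have e : ⟪ra P v, q⟫ / ⟪ra P v, o⟫ - ⟪o, q⟫ = ⟪resid o v P, q⟫ / c := by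
      rw [resid, hco, inner_sub_left, inner_smul_left]
      simp; field_simp
    rw [e, abs_div, abs_of_pos hcp, div_le_iff₀ hcp]
    linarith
  have hGc : μ Gᶜ ≤ ENNReal.ofReal (2 * δ) := by
    refine (measure_mono hbad).trans ((measure_union_le _ _).trans ((add_le_add hS hT).trans ?_))
    rw [← ENNReal.ofReal_add hδ0.le hδ0.le, two_mul]
  have h1 : (1 : ENNReal) ≤ μ G + ENNReal.ofReal (2 * δ) := by
    calc (1 : ENNReal) = μ (G ∪ Gᶜ) := by rw [Set.union_compl_self, measure_univ]
      _ ≤ μ G + μ Gᶜ := measure_union_le _ _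
      _ ≤ _ := by gcongr
  rw [ENNReal.ofReal_sub _ (by linarith), ENNReal.ofReal_one]
  exact tsub_le_iff_right.2 h1
end
end

section
/- Let D ≥ 1 and B ≥ 1 be integers and let o' ∈ ℝ^D satisfy o'[i] ≠ 0 for every coordinate i. If ȳ ∈ 𝒢 is a cosine maximizer of o' over 𝒢, then ȳ lies in the same orthant as o'; that is, ȳ[i] · o'[i] > 0 for every coordinate i. -/
open MeasureTheory
open scoped RealInnerProductSpace

noncomputable section

/-- if every coordinate of `o'` is nonzero and `ȳ` is a cosine maximizer of
`o'` over `𝒢`, then `ȳ` lies in the same orthant as `o'`: `ȳ i · o' i > 0` for every `i`. -/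
theorem cosine_maximizer_same_orthant (D B : ℕ) (hD : 1 ≤ D) (hB : 1 ≤ B)
    (o' ybar : EuclideanSpace ℝ (Fin D)) (ho' : ∀ i, o' i ≠ 0)
    (hmax : IsCosineMaximizer D B o' ybar) :
    ∀ i, 0 < ybar i * o' i := by
  intro i
  obtain ⟨hmem, hle⟩ := hmax
  by_contra hneg
  have hyi : ybar i ≠ 0 := by
    intro h0
    obtain ⟨u, hu, he⟩ := hmem i
    rw [h0] at he
    have h1 : (2 ^ B : ℝ) = 2 * u + 1 := by linarith
    have h2 : 2 ^ B = 2 * u + 1 := by exact_mod_cast h1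
    obtain ⟨k, rfl⟩ : ∃ k, B = k + 1 := ⟨B - 1, by omega⟩
    rw [pow_succ] at h2
    omega
  have hlt : ybar i * o' i < 0 :=
    lt_of_le_of_ne (not_lt.mp hneg) (mul_ne_zero hyi (ho' i))
  let y : EuclideanSpace ℝ (Fin D) :=
    WithLp.toLp 2 (fun j => if j = i then -ybar j else ybar j)
  have hyj : ∀ j, y j = if j = i then -ybar j else ybar j := fun j => rfl
  have hy : y ∈ gridSet D B := by
    intro j
    obtain ⟨u, hu, he⟩ := hmem j
    by_cases hj : j = i
    · refine ⟨2 ^ B - 1 - u, by omega, ?_⟩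
      have hc : ((2 ^ B - 1 - u : ℕ) : ℝ) = 2 ^ B - 1 - u := by
        rw [Nat.cast_sub (by omega), Nat.cast_sub (by omega)]
        push_cast
        ring
      rw [hyj, if_pos hj, hc, he]
      ring
    · exact ⟨u, hu, by rw [hyj, if_neg hj, he]⟩
  have hnorm : ‖y‖ = ‖ybar‖ := by
    rw [EuclideanSpace.norm_eq, EuclideanSpace.norm_eq]
    congr 1
    refine Finset.sum_congr rfl fun j _ => ?_
    rw [hyj]
    split_ifs <;> simp
  have hpos : 0 < ‖ybar‖ := by
    rw [norm_pos_iff]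
    intro h
    exact hyi (by rw [h]; rfl)
  have h := hle y hy
  rw [real_inner_smul_left, real_inner_smul_left, hnorm] at h
  have h' := le_of_mul_le_mul_left h (inv_pos.mpr hpos)
  refine absurd h' (not_le.mpr ?_)
  rw [PiLp.inner_apply, PiLp.inner_apply]
  refine Finset.sum_lt_sum (fun j _ => ?_) ⟨i, Finset.mem_univ i, ?_⟩
  · rw [hyj]
    split_ifs with hj
    · subst hj
      simp only [RCLike.inner_apply, conj_trivial]
      nlinarith
    · exact le_rfl
  · rw [hyj, if_pos rfl]
    simp only [RCLike.inner_apply, conj_trivial]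
    nlinarith
end
end

section
/- Let D ≥ 1 and B ≥ 1 be integers and let a ∈ ℝ^D satisfy a[i] > 0 for every coordinate i. Define g : (0, ∞) → ℤ^D by g(t)[i] = min( ⌊t · a[i]⌋, 2^{B−1} − 1 ). Then the image of g, i.e., the set { g(t) : t > 0 }, has at most D · 2^{B−1} elements. (Each coordinate of g is a nondecreasing step function taking values in {0, 1, ..., 2^{B−1} − 1}, so the number of distinct tuples produced as t ranges over (0, ∞) is at most D·(2^{B−1} − 1) + 1 ≤ D · 2^{B−1}.) -/
/-- for `a ∈ ℝ^D` with positive coordinates and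
`g(t)[i] = min(⌊t·a i⌋, 2^{B−1} − 1)`, the image `{g(t) : t > 0}` is finite and has at most
`D·2^{B−1}` elements. -/
theorem critical_value_enumeration_count (D B : ℕ) (hD : 1 ≤ D) (hB : 1 ≤ B)
    (a : Fin D → ℝ) (ha : ∀ i, 0 < a i) :
    {v : Fin D → ℤ | ∃ t : ℝ, 0 < t ∧
        v = fun i => min ⌊t * a i⌋ (2 ^ (B - 1) - 1)}.Finite ∧
      {v : Fin D → ℤ | ∃ t : ℝ, 0 < t ∧
          v = fun i => min ⌊t * a i⌋ (2 ^ (B - 1) - 1)}.ncard ≤ D * 2 ^ (B - 1) := by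
  have hP : (1 : ℤ) ≤ 2 ^ (B - 1) := one_le_pow₀ (by norm_num)
  set S := {v : Fin D → ℤ | ∃ t : ℝ, 0 < t ∧
        v = fun i => min ⌊t * a i⌋ (2 ^ (B - 1) - 1)} with hS
  have key : ∀ t s : ℝ, t ≤ s →
      ∑ i, min ⌊t * a i⌋ (2 ^ (B - 1) - 1) = ∑ i, min ⌊s * a i⌋ (2 ^ (B - 1) - 1) →
      (fun i => min ⌊t * a i⌋ ((2 : ℤ) ^ (B - 1) - 1)) =
        fun i => min ⌊s * a i⌋ (2 ^ (B - 1) - 1) := by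
    intro t s hts h
    have h2 := (Finset.sum_eq_sum_iff_of_le (fun i _ =>
      min_le_min_right _ (Int.floor_le_floor
        (mul_le_mul_of_nonneg_right hts (ha i).le)))).1 h
    funext i
    exact h2 i (Finset.mem_univ i)
  have hinj : Set.InjOn (fun v : Fin D → ℤ => ∑ i, v i) S := by
    rintro v ⟨t, ht, rfl⟩ w ⟨s, hs, rfl⟩ h
    rcases le_total t s with hts | hts
    · exact key t s hts h
    · exact (key s t hts h.symm).symm
  have hmaps : Set.MapsTo (fun v : Fin D → ℤ => ∑ i, v i) S
      (Finset.Icc (0 : ℤ) (D * (2 ^ (B - 1) - 1)) : Finset ℤ) := by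
    rintro v ⟨t, ht, rfl⟩
    simp only [Finset.coe_Icc, Set.mem_Icc]
    constructor
    · exact Finset.sum_nonneg fun i _ =>
        le_min (Int.floor_nonneg.2 (mul_pos ht (ha i)).le) (by linarith)
    · refine (Finset.sum_le_card_nsmul _ _ (2 ^ (B - 1) - 1) fun i _ => min_le_right _ _).trans ?_
      simp
  refine ⟨Set.Finite.of_injOn hmaps hinj (Finset.finite_toSet _), ?_⟩
  have h := Set.ncard_le_ncard_of_injOn _ hmaps hinj (Finset.finite_toSet _)
  rw [Set.ncard_coe_finset, Int.card_Icc] at h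
  refine h.trans ?_
  rw [Int.toNat_le]
  push_cast
  have : (1 : ℤ) ≤ D := by exact_mod_cast hD
  linarith
end
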